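/- arXiv:1707.02674 — 2 statements merged into one kernel-verified Lean document; each statement's English description precedes it below -/
import Mathlib

section
/- For every integer n ≥ 1: N(2,4;2n) = C(1,4;2n). -/
/-- The rank of a partition: its largest part minus its number of parts. -/
def partitionRank {n : ℕ} (π : n.Partition) : ℤ :=
  (π.parts.sup : ℤ) - π.parts.card

/-- The crank of a partition: the largest part if there are no parts equal to 1,
otherwise the number of parts larger than the number of ones minus the number of ones. -/
def partitionCrank {n : ℕ} (π : n.Partition) : ℤ :=
  if π.parts.count 1 = 0 then (π.parts.sup : ℤ)
  else ((π.parts.filter (fun x => π.parts.count 1 < x)).card : ℤ) - π.parts.count 1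

/-- `N(a,M;n)`: the number of partitions of `n` whose rank is congruent to `a` modulo `M`. -/
def rankCount (a : ℤ) (M : ℕ) (n : ℕ) : ℕ :=
  (Finset.univ.filter (fun π : n.Partition => partitionRank π % M = a % M)).card

/-- `C(a,M;n)`: the number of partitions of `n` whose crank is congruent to `a` modulo `M`. -/
def crankCount (a : ℤ) (M : ℕ) (n : ℕ) : ℕ :=
  (Finset.univ.filter (fun π : n.Partition => partitionCrank π % M = a % M)).card

namespace RC

open PowerSeries Finset

local notation "A" => PowerSeries ℂ

/-- Formal sum of a sequence whose `n`th term is divisible by `X^n`. -/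
noncomputable def S (g : ℕ → PowerSeries ℂ) : PowerSeries ℂ :=
  PowerSeries.mk fun k => ∑ n ∈ range (k + 1), coeff k (g n)

/-- Admissible sequences. -/
def Adm (g : ℕ → PowerSeries ℂ) : Prop := ∀ n, (X : PowerSeries ℂ) ^ n ∣ g n

lemma coeff_S (g : ℕ → A) (k : ℕ) : coeff k (S g) = ∑ n ∈ range (k + 1), coeff k (g n) := by
  simp [S]

lemma coeff_S_of_lt {g : ℕ → A} (hg : Adm g) {k K : ℕ} (h : k < K) :
    coeff k (S g) = ∑ n ∈ range K, coeff k (g n) := by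
  rw [coeff_S]
  apply Finset.sum_subset
  · intro x; simp; omega
  · intro n _ hn
    simp at hn
    exact X_pow_dvd_iff.1 (hg n) k (by omega)

lemma S_congr {g h : ℕ → A} (e : ∀ n, g n = h n) : S g = S h := by
  rw [funext e]

lemma S_add (g h : ℕ → A) : S (fun n => g n + h n) = S g + S h := by
  ext k; simp [coeff_S, Finset.sum_add_distrib]

lemma S_sub (g h : ℕ → A) : S (fun n => g n - h n) = S g - S h := by
  ext k; simp [coeff_S, Finset.sum_sub_distrib]

lemma S_mul {g : ℕ → A} (c : A) (hg : Adm g) : S (fun n => c * g n) = c * S g := by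
  ext k
  rw [coeff_S, coeff_mul]
  simp_rw [coeff_mul]
  rw [Finset.sum_comm]
  apply Finset.sum_congr rfl
  intro x hx
  have := mem_antidiagonal.1 hx
  rw [coeff_S_of_lt hg (show x.2 < k + 1 by omega), Finset.mul_sum]

lemma S_succ {g : ℕ → A} (hg : Adm g) : S g = g 0 + S (fun n => g (n + 1)) := by
  ext k
  rw [coeff_S_of_lt hg (show k < k + 2 by omega), Finset.sum_range_succ', map_add, coeff_S]
  ring

lemma S_comm (g : ℕ → ℕ → A) :
    S (fun n => S (fun m => g n m)) = S (fun m => S (fun n => g n m)) := by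
  ext k
  simp only [coeff_S]
  rw [Finset.sum_comm]

lemma sum_parity (f : ℕ → ℂ) (k : ℕ) : ∑ n ∈ range (2 * k), f n =
    ∑ n ∈ range k, f (2 * n) + ∑ n ∈ range k, f (2 * n + 1) := by
  induction k with
  | zero => simp
  | succ k ih =>
    rw [show 2 * (k + 1) = 2 * k + 1 + 1 by ring, sum_range_succ, sum_range_succ, ih,
      sum_range_succ, sum_range_succ]
    ring

lemma S_parity {g : ℕ → A} (hg : Adm g) :
    S g = S (fun n => g (2 * n)) + S (fun n => g (2 * n + 1)) := by
  ext k
  rw [coeff_S_of_lt hg (show k < 2 * (k + 1) by omega), sum_parity, map_add, coeff_S, coeff_S]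

lemma Adm_shift {g : ℕ → A} (hg : Adm g) : Adm (fun n => g (n + 1)) :=
  fun n => (pow_dvd_pow X (Nat.le_succ n)).trans (hg (n + 1))

lemma Adm_pow {x : A} (hx : X ∣ x) (f : ℕ → A) : Adm (fun n => x ^ n * f n) :=
  fun n => Dvd.dvd.mul_right (pow_dvd_pow_of_dvd hx n) _

lemma Adm_Xpow (f : ℕ → A) (e : ℕ → ℕ) (he : ∀ n, n ≤ e n) (g : ℕ → A) :
    Adm (fun n => f n * X ^ (e n) * g n) :=
  fun n => Dvd.dvd.mul_right (Dvd.dvd.mul_left (pow_dvd_pow X (he n)) _) _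

lemma eq_zero_of_dvd {a : A} (h : ∀ n : ℕ, X ^ n ∣ a) : a = 0 := by
  ext k
  exact X_pow_dvd_iff.1 (h (k + 1)) k (by omega)

lemma cc_zero {x : A} (hx : X ∣ x) : constantCoeff x = 0 := X_dvd_iff.1 hx

/-- finite product `(a;p)_n` -/
noncomputable def poch (a p : PowerSeries ℂ) (n : ℕ) : PowerSeries ℂ :=
  ∏ i ∈ range n, (1 - a * p ^ i)

lemma poch_zero (a p : A) : poch a p 0 = 1 := by simp [poch]
lemma poch_succ (a p : A) (n : ℕ) : poch a p (n + 1) = poch a p n * (1 - a * p ^ n) := by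
  simp [poch, prod_range_succ]
lemma poch_succ' (a p : A) (n : ℕ) : poch a p (n + 1) = (1 - a) * poch (a * p) p n := by
  rw [poch, prod_range_succ', poch, mul_comm]
  congr 1
  · simp
  · apply prod_congr rfl; intros; ring

lemma poch_cc {a : A} (ha : X ∣ a) (p : A) (n : ℕ) : constantCoeff (poch a p n) = 1 := by
  simp [poch, map_prod, cc_zero ha]

/-- `1/(a;p)_n` -/
noncomputable def ip (a p : PowerSeries ℂ) (n : ℕ) : PowerSeries ℂ := (poch a p n)⁻¹

lemma ip_mul {a : A} (ha : X ∣ a) (p : A) (n : ℕ) : poch a p n * ip a p n = 1 :=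
  PowerSeries.mul_inv_cancel _ (by rw [poch_cc ha]; simp)

lemma ip_zero (a p : A) : ip a p 0 = 1 := by
  simp [ip, poch_zero]

lemma ip_unique {a : A} (ha : X ∣ a) {p : A} {n : ℕ} {b : A} (h : poch a p n * b = 1) :
    b = ip a p n := by
  calc b = b * (poch a p n * ip a p n) := by rw [ip_mul ha, mul_one]
    _ = (poch a p n * b) * ip a p n := by ring
    _ = _ := by rw [h, one_mul]

lemma ip_succ {a : A} (ha : X ∣ a) (p : A) (n : ℕ) :
    ip a p n = (1 - a * p ^ n) * ip a p (n + 1) := by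
  symm
  apply ip_unique ha
  rw [← mul_assoc, ← poch_succ, ip_mul ha]

lemma ip_succ' {a : A} (ha : X ∣ a) (p : A) (n : ℕ) :
    ip (a * p) p n = (1 - a) * ip a p (n + 1) := by
  symm
  apply ip_unique (Dvd.dvd.mul_right ha p)
  rw [← mul_assoc, mul_comm _ (1 - a), ← poch_succ', ip_mul ha]

/-- `r p n = 1/(p;p)_n` -/
noncomputable def r (p : PowerSeries ℂ) (n : ℕ) : PowerSeries ℂ := ip p p n

lemma r_succ {p : A} (hp : X ∣ p) (n : ℕ) : r p n = (1 - p ^ (n + 1)) * r p (n + 1) := by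
  rw [r, ip_succ hp, r, pow_succ']

/-- `1/(x;p)_∞` -/
noncomputable def E (p x : PowerSeries ℂ) : PowerSeries ℂ := S fun n => x ^ n * r p n

lemma E_eq {p x : A} (hx : X ∣ x) : E p x = 1 + S fun n => x ^ (n + 1) * r p (n + 1) := by
  rw [E, S_succ (Adm_pow hx _)]
  simp [r, ip_zero]

lemma E_shift {p x : A} (hp : X ∣ p) (hx : X ∣ x) : E p (x * p) = (1 - x) * E p x := by
  have h1 := E_eq (p := p) hx
  have h2 := E_eq (p := p) (hx.mul_right p)
  have h3 : (S fun n => x ^ (n + 1) * r p (n + 1)) - (S fun n => (x * p) ^ (n + 1) * r p (n + 1))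
      = x * E p x := by
    rw [← S_sub, E, ← S_mul _ (Adm_pow hx _)]
    apply S_congr
    intro n
    rw [r_succ hp n]
    ring
  linear_combination h2 - h1 - h3

lemma E_shift_n {p x : A} (hp : X ∣ p) (hx : X ∣ x) (n : ℕ) :
    E p (x * p ^ n) = poch x p n * E p x := by
  induction n with
  | zero => simp [poch_zero]
  | succ n ih =>
    rw [pow_succ, ← mul_assoc, E_shift hp (hx.mul_right _), ih, poch_succ]
    ring

lemma E_sub_one {p x : A} (hx : X ∣ x) : x ∣ E p x - 1 := by
  rw [E_eq hx]
  refine ⟨S fun n => x ^ n * r p (n + 1), ?_⟩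
  rw [← S_mul _ (Adm_pow hx _), add_sub_cancel_left]
  apply S_congr; intro n; ring

lemma E_ne {p x : A} (hx : X ∣ x) : E p x ≠ 0 := by
  intro h
  have := (hx.trans (E_sub_one (p := p) hx))
  have := cc_zero this
  simp [h] at this

lemma uniq {p : A} (hp : X ∣ p) (D : A → A) (h : ∀ x, X ∣ x → D (x * p) ∣ D x)
    (h0 : ∀ x, X ∣ x → x ∣ D x) (x : A) (hx : X ∣ x) : D x = 0 := by
  apply eq_zero_of_dvd
  intro n
  have h1 : D (x * p ^ n) ∣ D x := by
    induction n with
    | zero => simp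
    | succ n ih =>
      rw [pow_succ, ← mul_assoc]
      exact (h _ (hx.mul_right _)).trans ih
  have h2 : X ^ n ∣ x * p ^ n := (pow_dvd_pow_of_dvd hp n).mul_left x
  exact h2.trans ((h0 _ (hx.mul_right _)).trans h1)

lemma one_sub_dvd {x : A} (hx : X ∣ x) (a : A) : (1 - x) * a ∣ a := by
  have : (1 - x) * (1 - x)⁻¹ = 1 := PowerSeries.mul_inv_cancel _ (by simp [cc_zero hx])
  exact ⟨(1 - x)⁻¹, by linear_combination -a * this⟩

/-- the `q`-binomial series -/
noncomputable def Q (p a x : PowerSeries ℂ) : PowerSeries ℂ :=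
  S fun n => x ^ n * (poch a p n * r p n)

lemma Q_eq {p a x : A} (hx : X ∣ x) :
    Q p a x = 1 + S fun n => x ^ (n + 1) * (poch a p (n + 1) * r p (n + 1)) := by
  rw [Q, S_succ (Adm_pow hx _)]
  simp [r, ip_zero, poch_zero]

lemma Q_shift {p a x : A} (hp : X ∣ p) (hx : X ∣ x) :
    (1 - x) * Q p a x = (1 - a * x) * Q p a (x * p) := by
  have h1 := Q_eq (p := p) (a := a) hx
  have h2 := Q_eq (p := p) (a := a) (hx.mul_right p)
  have h3 : (S fun n => x ^ (n + 1) * (poch a p (n + 1) * r p (n + 1))) -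
      (S fun n => (x * p) ^ (n + 1) * (poch a p (n + 1) * r p (n + 1)))
      = x * Q p a x - x * a * Q p a (x * p) := by
    rw [← S_sub, Q, Q, ← S_mul _ (Adm_pow hx _), ← S_mul _ (Adm_pow (hx.mul_right p) _), ← S_sub]
    apply S_congr
    intro n
    rw [r_succ hp n, poch_succ]
    ring
  linear_combination h1 - h2 + h3

lemma Q_sub_one {p a x : A} (hx : X ∣ x) : x ∣ Q p a x - 1 := by
  rw [Q_eq hx]
  refine ⟨S fun n => x ^ n * (poch a p (n + 1) * r p (n + 1)), ?_⟩
  rw [← S_mul _ (Adm_pow hx _), add_sub_cancel_left]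
  apply S_congr; intro n; ring

theorem q_binomial {p a x : A} (hp : X ∣ p) (hx : X ∣ x) : Q p a x * E p (a * x) = E p x := by
  rw [← sub_eq_zero]
  refine uniq hp (fun x => Q p a x * E p (a * x) - E p x) ?_ ?_ x hx
  · intro x hx
    have e1 := Q_shift (a := a) hp hx
    have e2 := E_shift hp hx
    have e3 := E_shift hp (hx.mul_left a)
    have : Q p a (x * p) * E p (a * (x * p)) - E p (x * p) =
        (1 - x) * (Q p a x * E p (a * x) - E p x) := by
      rw [← mul_assoc a, e2, e3]
      linear_combination - E p (a * x) * e1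
    simp only [this]
    exact one_sub_dvd hx _
  · intro x hx
    obtain ⟨u, hu⟩ := Q_sub_one (p := p) (a := a) hx
    obtain ⟨v, hv⟩ := E_sub_one (p := p) hx
    obtain ⟨w, hw⟩ := E_sub_one (p := p) (hx.mul_left a)
    exact ⟨u * E p (a * x) + a * w - v, by linear_combination E p (a * x) * hu + hw - hv⟩

/-- `(x;p)_∞` as Euler's series -/
noncomputable def e (p x : PowerSeries ℂ) : PowerSeries ℂ :=
  S fun n => x ^ n * ((-1) ^ n * (∏ i ∈ range n, p ^ i) * r p n)

theorem euler {p x : A} (hp : X ∣ p) (hx : X ∣ x) : e p x * E p x = 1 := by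
  have e_eq : ∀ x : A, X ∣ x → e p x = 1 + S fun n => x ^ (n + 1) *
      ((-1) ^ (n + 1) * (∏ i ∈ range (n + 1), p ^ i) * r p (n + 1)) := by
    intro x hx
    rw [e, S_succ (Adm_pow hx _)]
    simp [r, ip_zero]
  rw [← sub_eq_zero]
  refine uniq hp (fun x => e p x * E p x - 1) ?_ ?_ x hx
  · intro x hx
    have h1 := e_eq x hx
    have h2 := e_eq _ (hx.mul_right p)
    have h3 : (S fun n => x ^ (n + 1) *
      ((-1) ^ (n + 1) * (∏ i ∈ range (n + 1), p ^ i) * r p (n + 1))) -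
      (S fun n => (x * p) ^ (n + 1) *
      ((-1) ^ (n + 1) * (∏ i ∈ range (n + 1), p ^ i) * r p (n + 1)))
        = - x * e p (x * p) := by
      rw [← S_sub, e, ← S_mul _ (Adm_pow (hx.mul_right p) _)]
      apply S_congr
      intro n
      rw [r_succ hp n, prod_range_succ]
      ring
    have h4 : e p x = (1 - x) * e p (x * p) := by linear_combination h1 - h2 + h3
    have : e p (x * p) * E p (x * p) - 1 = e p x * E p x - 1 := by
      rw [h4, E_shift hp hx]; ring
    simp only [this]
    exact dvd_rfl
  · intro x hx
    have : x ∣ e p x - 1 := by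
      rw [e_eq x hx]
      refine ⟨S fun n => x ^ n *
        ((-1) ^ (n + 1) * (∏ i ∈ range (n + 1), p ^ i) * r p (n + 1)), ?_⟩
      rw [← S_mul _ (Adm_pow hx _), add_sub_cancel_left]
      apply S_congr; intro n; ring
    obtain ⟨u, hu⟩ := this
    obtain ⟨v, hv⟩ := E_sub_one (p := p) hx
    exact ⟨u * E p x + v, by linear_combination E p x * hu + hv⟩

lemma X_dvd_sq : (X : A) ∣ X ^ 2 := ⟨X, by ring⟩

theorem E_split {x : A} (hx : X ∣ x) : E X x = E (X ^ 2) x * E (X ^ 2) (x * X) := by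
  rw [← sub_eq_zero]
  refine uniq dvd_rfl (fun x => E X x - E (X ^ 2) x * E (X ^ 2) (x * X)) ?_ ?_ x hx
  · intro x hx
    have : E X (x * X) - E (X ^ 2) (x * X) * E (X ^ 2) (x * X * X) =
        (1 - x) * (E X x - E (X ^ 2) x * E (X ^ 2) (x * X)) := by
      rw [E_shift dvd_rfl hx, mul_assoc x, ← sq, E_shift X_dvd_sq hx]; ring
    simp only [this]
    exact one_sub_dvd hx _
  · intro x hx
    obtain ⟨u, hu⟩ := E_sub_one (p := X ^ 2) hx
    obtain ⟨v, hv⟩ := E_sub_one (p := X) hx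
    obtain ⟨w, hw⟩ := E_sub_one (p := X ^ 2) (hx.mul_right X)
    exact ⟨v - u * E (X ^ 2) (x * X) - X * w, by
      linear_combination hv - E (X ^ 2) (x * X) * hu - hw⟩

lemma X_dvd_neg : (X : A) ∣ -X := ⟨-1, by ring⟩
lemma X_dvd_negsq : (X : A) ∣ -X ^ 2 := ⟨-X, by ring⟩

/-- general double sum of the crank generating function -/
noncomputable def U (y z : ℂ) : PowerSeries ℂ :=
  S fun w => S fun m => (C y ^ w * C z ^ m * X ^ (w + m + w * m)) * (r X w * r X m)

lemma U_symm (y z : ℂ) : U y z = U z y := by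
  rw [U, S_comm, U]
  apply S_congr; intro m
  apply S_congr; intro w
  rw [show m + w + m * w = w + m + w * m by ring]
  ring

lemma U_eq (y z : ℂ) :
    U y z = S fun w => (C y * X) ^ w * (r X w * E X (C z * X ^ (w + 1))) := by
  rw [U]
  apply S_congr; intro w
  rw [E, ← S_mul _ (Adm_pow (Dvd.dvd.mul_left (dvd_pow_self X (by omega)) _) _),
    ← S_mul]
  · apply S_congr; intro m
    ring
  · intro n
    refine Dvd.dvd.mul_left ?_ _
    exact (Adm_pow (Dvd.dvd.mul_left (dvd_pow_self X (by omega)) _) _) n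

/-- `(1-q) U(-1,-1) = (q)_∞/(-q)_∞^2` -/
lemma U_neg : E X X * ((1 - X) * U (-1) (-1)) = E X (-X) ^ 2 := by
  have h1 : U (-1) (-1) = E X (-X) * Q X (-X) (-X) := by
    rw [U_eq, Q, ← S_mul _ (Adm_pow X_dvd_neg _)]
    apply S_congr; intro w
    rw [show (C (-1 : ℂ) * X ^ (w + 1) : A) = (-X) * X ^ w by simp; ring,
      E_shift_n dvd_rfl X_dvd_neg, show (C (-1 : ℂ) * X : A) = -X by simp]
    ring
  have h2 := q_binomial (p := X) (a := -X) dvd_rfl X_dvd_neg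
  have h3 := E_shift (p := X) dvd_rfl (dvd_refl X)
  rw [neg_mul_neg, h3] at h2
  rw [h1]
  linear_combination E X (-X) * h2

/-- the auxiliary double sum -/
noncomputable def T (ε : PowerSeries ℂ) : PowerSeries ℂ :=
  S fun m => S fun j => ((-1) ^ m * ε ^ j * X ^ (m + j + m * j)) * (r (X ^ 2) m * r X j)

lemma poch_sq (m : ℕ) : poch (X : A) X m * poch (-X) X m = poch (X ^ 2) (X ^ 2) m := by
  rw [poch, poch, poch, ← prod_mul_distrib]
  apply prod_congr rfl; intros; ring

lemma T_eq (ε : A) :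
    T ε = S fun m => (-X) ^ m * (r (X ^ 2) m * E X (ε * X * X ^ m)) := by
  rw [T]
  apply S_congr; intro m
  have hd : X ∣ ε * X * X ^ m := Dvd.dvd.mul_right (Dvd.dvd.mul_left dvd_rfl _) _
  rw [E, ← S_mul _ (Adm_pow hd _), ← S_mul]
  · apply S_congr; intro j
    rw [neg_pow X m]
    ring
  · intro n
    exact Dvd.dvd.mul_left (Adm_pow hd _ n) _

/-- `F b t = ∑ t^n/(bq)_n` -/
noncomputable def F (b t : PowerSeries ℂ) : PowerSeries ℂ := S fun n => t ^ n * ip (b * X) X n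

lemma T_one : T 1 = E X X * F (-1) (-X) := by
  rw [T_eq, F, ← S_mul _ (Adm_pow X_dvd_neg _)]
  apply S_congr; intro m
  rw [one_mul, E_shift_n dvd_rfl dvd_rfl, neg_one_mul]
  have h1 := ip_mul (X_dvd_sq) (X ^ 2) m
  have : poch X X m * r (X ^ 2) m = ip (-X) X m := by
    apply ip_unique X_dvd_neg
    rw [← ip_mul (X_dvd_sq) (X ^ 2) m, ← poch_sq, r]
    ring
  linear_combination (-X) ^ m * E X X * this

lemma T_neg : T (-1) = E X (-X) ^ 2 := by
  have hs : E X (-X) ^ 2 = S fun m => E X (-X) * ((-X) ^ m * r X m) := by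
    rw [S_mul _ (Adm_pow X_dvd_neg _), sq, ← E]
  rw [T_eq, hs]
  apply S_congr; intro m
  rw [neg_one_mul, E_shift_n dvd_rfl X_dvd_neg]
  have : poch (-X) X m * r (X ^ 2) m = r X m := by
    apply ip_unique dvd_rfl
    rw [← ip_mul (X_dvd_sq) (X ^ 2) m, ← poch_sq, r]
    ring
  linear_combination (-X) ^ m * E X (-X) * this

lemma T_eq' (ε : A) :
    T ε = S fun j => (ε * X) ^ j * (r X j * E (X ^ 2) (-X ^ (j + 1))) := by
  rw [T, S_comm]
  apply S_congr; intro j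
  have hd : (X : A) ∣ -X ^ (j + 1) := (dvd_neg.2 (dvd_pow_self X (by omega)))
  rw [E, ← S_mul _ (Adm_pow hd _), ← S_mul]
  · apply S_congr; intro m
    rw [neg_pow (X ^ (j + 1)) m]
    ring
  · intro n
    exact Dvd.dvd.mul_left (Adm_pow hd _ n) _

/-- `φ(-q)` -/
noncomputable def Phi' : PowerSeries ℂ := S fun m => (-1) ^ m * X ^ (m ^ 2) * ip (-X ^ 2) (X ^ 2) m

lemma poch_odd (k : ℕ) : poch (X : A) X (2 * k + 1) =
    poch (X ^ 2) (X ^ 2) k * poch X (X ^ 2) (k + 1) := by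
  induction k with
  | zero => simp [poch_succ, poch_zero]
  | succ k ih =>
    rw [show 2 * (k + 1) + 1 = 2 * k + 1 + 1 + 1 by ring, poch_succ, poch_succ, ih,
      poch_succ _ _ (k + 1), poch_succ (X ^ 2) _ k]
    ring

lemma r_odd (k : ℕ) : (r X (2 * k + 1) : A) =
    r (X ^ 2) k * (E (X ^ 2) X * e (X ^ 2) (X * (X ^ 2) ^ (k + 1))) := by
  symm
  apply ip_unique dvd_rfl
  rw [poch_odd]
  have h1 := ip_mul (X_dvd_sq) (X ^ 2) k
  have h2 := euler X_dvd_sq (Dvd.dvd.mul_right (dvd_refl (X : A)) ((X ^ 2) ^ (k + 1)))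
  rw [E_shift_n X_dvd_sq dvd_rfl] at h2
  rw [r]
  linear_combination poch X (X ^ 2) (k + 1) * E (X ^ 2) X *
    e (X ^ 2) (X * (X ^ 2) ^ (k + 1)) * h1 + h2

lemma prodX (m : ℕ) : (∏ i ∈ range m, ((X : A) ^ 2) ^ i) * X ^ (3 * m + 1) = X ^ ((m + 1) ^ 2) := by
  induction m with
  | zero => simp
  | succ m ih =>
    rw [prod_range_succ, show ((m + 1 + 1) ^ 2) = (m + 1) ^ 2 + (2 * m + 3) by ring, pow_add _ ((m + 1) ^ 2), ← ih]
    ring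

lemma Adm_Phi : Adm (fun m => (-1) ^ m * X ^ (m ^ 2) * ip (-X ^ 2) (X ^ 2) m) :=
  Adm_Xpow _ _ (fun n => Nat.le_self_pow (by norm_num) n) _

lemma Todd : (S fun k => X ^ (2 * k + 1) * (r X (2 * k + 1) * E (X ^ 2) (-X ^ (2 * k + 1 + 1)))) =
    E X X * (1 - Phi') := by
  have hq : ∀ m, Q (X ^ 2) (-X ^ 2) ((X ^ 2) ^ (m + 1)) * r (X ^ 2) m * E (X ^ 2) (-X ^ 2) =
      E (X ^ 2) (X ^ 2) * ip (-X ^ 2) (X ^ 2) (m + 1) := by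
    intro m
    have hx : (X : A) ∣ (X ^ 2) ^ (m + 1) := X_dvd_sq.trans (dvd_pow_self _ (by omega))
    have h := q_binomial (p := X ^ 2) (a := -X ^ 2) X_dvd_sq hx
    have h2 := E_shift_n (p := X ^ 2) (x := X ^ 2) X_dvd_sq X_dvd_sq m
    rw [E_shift_n X_dvd_sq X_dvd_negsq, show ((X : A) ^ 2) ^ (m + 1) = X ^ 2 * (X ^ 2) ^ m by ring,
      h2] at h
    have h3 := ip_mul (X_dvd_sq) (X ^ 2) m
    have h4 := ip_mul (X_dvd_negsq) (X ^ 2) (m + 1)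
    rw [show ((X : A) ^ 2) ^ (m + 1) = X ^ 2 * (X ^ 2) ^ m by ring, r]
    linear_combination ip (X ^ 2) (X ^ 2) m * ip (-X ^ 2) (X ^ 2) (m + 1) * h
      - Q (X ^ 2) (-X ^ 2) (X ^ 2 * (X ^ 2) ^ m) * ip (X ^ 2) (X ^ 2) m * E (X ^ 2) (-X ^ 2) * h4
      + E (X ^ 2) (X ^ 2) * ip (-X ^ 2) (X ^ 2) (m + 1) * h3
  have hPhi : 1 - Phi' =
      S fun m => (-1) ^ m * X ^ ((m + 1) ^ 2) * ip (-X ^ 2) (X ^ 2) (m + 1) := by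
    have h := S_succ Adm_Phi
    rw [← Phi'] at h
    have h' : (S fun m => (-1 : A) ^ (m + 1) * X ^ ((m + 1) ^ 2) * ip (-X ^ 2) (X ^ 2) (m + 1)) =
      (-1) * S fun m => (-1) ^ m * X ^ ((m + 1) ^ 2) * ip (-X ^ 2) (X ^ 2) (m + 1) := by
      rw [← S_mul _ (Adm_Xpow _ _ (fun n => by nlinarith) _)]
      apply S_congr; intro n; ring
    rw [h'] at h
    simp [ip_zero] at h
    rw [h]; ring
  have hE := E_split (dvd_refl (X : A))
  rw [hPhi, hE, ← sq]
  have step : ∀ k, X ^ (2 * k + 1) * (r X (2 * k + 1) * E (X ^ 2) (-X ^ (2 * k + 1 + 1))) =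
      S fun m => (E (X ^ 2) (-X ^ 2) * E (X ^ 2) X * ((-1) ^ m * X ^ ((m + 1) ^ 2) * r (X ^ 2) m)) *
        (((X ^ 2) ^ (m + 1)) ^ k * (poch (-X ^ 2) (X ^ 2) k * r (X ^ 2) k)) := by
    intro k
    have hd : (X : A) ∣ X * (X ^ 2) ^ (k + 1) := Dvd.dvd.mul_right (dvd_refl (X : A)) _
    rw [r_odd, show (-X ^ (2 * k + 1 + 1) : A) = -X ^ 2 * (X ^ 2) ^ k by ring,
      E_shift_n X_dvd_sq X_dvd_negsq, e]
    rw [show ∀ s : A, X ^ (2 * k + 1) * (r (X ^ 2) k * (E (X ^ 2) X * s) *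
      (poch (-X ^ 2) (X ^ 2) k * E (X ^ 2) (-X ^ 2))) =
      (X ^ (2 * k + 1) * (r (X ^ 2) k * E (X ^ 2) X *
      (poch (-X ^ 2) (X ^ 2) k * E (X ^ 2) (-X ^ 2)))) * s by intro s; ring,
      ← S_mul _ (Adm_pow hd _)]
    apply S_congr; intro m
    rw [← prodX m]
    ring
  rw [S_congr step, S_comm, ← S_mul _ (Adm_Xpow _ _ (fun n => by nlinarith) _)]
  apply S_congr; intro m
  have hx : (X : A) ∣ (X ^ 2) ^ (m + 1) := X_dvd_sq.trans (dvd_pow_self _ (by omega))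
  rw [S_mul _ (Adm_pow hx _), ← Q]
  linear_combination E (X ^ 2) X * (-1) ^ m * X ^ ((m + 1) ^ 2) * hq m

/-- Watson's identity. -/
theorem watson : F (-1) (-X) - (1 - X) * U (-1) (-1) = 2 * (1 - Phi') := by
  have h1 := T_one
  have h2 := T_neg
  rw [← U_neg] at h2
  have h3 : T 1 - T (-1) = 2 * (E X X * (1 - Phi')) := by
    rw [T_eq', T_eq', S_parity (Adm_pow (Dvd.dvd.mul_left dvd_rfl _) _),
      S_parity (g := fun j => (-1 * X) ^ j * (r X j * E (X ^ 2) (-X ^ (j + 1))))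
        (Adm_pow (Dvd.dvd.mul_left dvd_rfl _) _), ← Todd]
    have a1 : (S fun n => (-1 * X : A) ^ (2 * n) * (r X (2 * n) * E (X ^ 2) (-X ^ (2 * n + 1)))) =
      S fun n => (1 * X) ^ (2 * n) * (r X (2 * n) * E (X ^ 2) (-X ^ (2 * n + 1))) := by
      apply S_congr; intro n
      rw [mul_pow, mul_pow, (even_two_mul n).neg_one_pow, one_pow]
    have a2 : (S fun n => (-1 * X : A) ^ (2 * n + 1) *
        (r X (2 * n + 1) * E (X ^ 2) (-X ^ (2 * n + 1 + 1)))) = (-1) *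
      S fun k => X ^ (2 * k + 1) * (r X (2 * k + 1) * E (X ^ 2) (-X ^ (2 * k + 1 + 1))) := by
      rw [← S_mul]
      · apply S_congr; intro n
        rw [mul_pow, (odd_two_mul_add_one n).neg_one_pow]; ring
      · exact fun n => Dvd.dvd.mul_right (pow_dvd_pow X (by omega)) _
    rw [a1, a2]
    simp only [one_mul]
    ring
  apply mul_left_cancel₀ (E_ne (p := X) (dvd_refl (X : A)))
  linear_combination h3 - h1 + h2

/-- `φ(q)` -/
noncomputable def Phi : PowerSeries ℂ := S fun m => X ^ (m ^ 2) * ip (-X ^ 2) (X ^ 2) m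

lemma F_one {b t : A} (ht : X ∣ t) : F b t = 1 + t * (1 - b * X)⁻¹ * F (b * X) t := by
  rw [F, S_succ (Adm_pow ht _), F, ← S_mul _ (Adm_pow ht _), ip_zero, pow_zero, one_mul]
  congr 1
  apply S_congr; intro n
  have h : (X : A) ∣ b * X := Dvd.dvd.mul_left dvd_rfl _
  have hc : (1 - b * X) * (1 - b * X)⁻¹ = 1 :=
    PowerSeries.mul_inv_cancel _ (by simp)
  rw [ip_succ' h]
  linear_combination - t ^ (n + 1) * ip (b * X) X (n + 1) * hc

lemma F_two {b t : A} (ht : X ∣ t) : (1 - t) * F b t = 1 - b + b * F b (t * X) := by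
  have hF : ∀ t : A, X ∣ t → F b t = 1 + S fun n => t ^ (n + 1) * ip (b * X) X (n + 1) := by
    intro t ht
    rw [F, S_succ (Adm_pow ht _), ip_zero, pow_zero, one_mul]
  have h1 := hF t ht
  have h2 := hF _ (ht.mul_right X)
  have h : (X : A) ∣ b * X := Dvd.dvd.mul_left dvd_rfl _
  have h3 : (S fun n => t ^ (n + 1) * ip (b * X) X (n + 1)) -
    b * (S fun n => (t * X) ^ (n + 1) * ip (b * X) X (n + 1)) = t * F b t := by
    rw [F, ← S_mul _ (Adm_shift (Adm_pow (ht.mul_right X) _)), ← S_mul _ (Adm_pow ht _), ← S_sub]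
    apply S_congr; intro n
    rw [ip_succ h X n]
    ring
  linear_combination h1 - b * h2 + h3

/-- Fine's transformation at `z² = -1`. -/
theorem fine (z : ℂ) (hz : z * z = -1) : 1 - C (-z) + C (-z) * F (C (-z)) (C z * X) = Phi := by
  have hzz : (C z * C z : A) = -1 := by rw [← map_mul, hz]; simp
  let G : ℕ → A := fun N => 1 - C (-z) * X ^ N + C (-z) * X ^ N * F (C (-z) * X ^ N) (C z * X ^ N * X)
  let P : ℕ → A := fun N => S fun m => (X ^ (2 * N)) ^ m * X ^ (m ^ 2) * ip (-X ^ (2 * N + 2)) (X ^ 2) m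
  have hu : ∀ N : ℕ, (1 + X ^ (2 * N + 2) : A) * (1 + X ^ (2 * N + 2))⁻¹ = 1 := fun N =>
    PowerSeries.mul_inv_cancel _ (by simp)
  have hG : ∀ N, G N = 1 + X ^ (2 * N + 1) * (1 + X ^ (2 * N + 2))⁻¹ * G (N + 1) := by
    intro N
    have ht : (X : A) ∣ C z * X ^ N * X := Dvd.dvd.mul_left dvd_rfl _
    have h1 := F_one (b := C (-z) * X ^ N) ht
    have h2 := F_two (b := C (-z) * X ^ N * X) ht
    have hc : (1 - C (-z) * X ^ N * X : A) * (1 - C (-z) * X ^ N * X)⁻¹ = 1 :=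
      PowerSeries.mul_inv_cancel _ (by simp)
    have hG' : G (N + 1) = 1 - C (-z) * X ^ N * X + C (-z) * X ^ N * X *
        F (C (-z) * X ^ N * X) (C z * X ^ N * X * X) := by
      simp only [G, pow_succ, mul_assoc]
    rw [hG', ← h2]
    simp only [G]
    rw [h1]
    have h3 := hu N
    set i1 := (1 - C (-z) * X ^ N * X : A)⁻¹
    set i2 := (1 + X ^ (2 * N + 2) : A)⁻¹
    set f := F (C (-z) * X ^ N * X) (C z * X ^ N * X)
    have hf : (1 - C (-z) * X ^ N * X : A) * (1 - C z * X ^ N * X) = 1 + X ^ (2 * N + 2) := by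
      rw [map_neg]
      linear_combination - X ^ (2 * N + 2) * hzz
    have h4 : i1 = (1 - C z * X ^ N * X) * i2 := by
      linear_combination -i1 * h3 + (1 - C z * X ^ N * X) * i2 * hc - i1 * i2 * hf
    have h5 : (C (-z) * C z : A) = 1 := by rw [map_neg]; linear_combination -hzz
    rw [h4]
    linear_combination X ^ (2 * N + 1) * (1 - C z * X ^ N * X) * i2 * f * h5
  have hP : ∀ N, P N = 1 + X ^ (2 * N + 1) * (1 + X ^ (2 * N + 2))⁻¹ * P (N + 1) := by
    intro N
    have ad : ∀ N : ℕ, Adm (fun m => (X ^ (2 * N) : A) ^ m * X ^ (m ^ 2) *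
        ip (-X ^ (2 * N + 2)) (X ^ 2) m) :=
      fun N => Adm_Xpow _ _ (fun n => Nat.le_self_pow (by norm_num) n) _
    simp only [P]
    rw [S_succ (ad N), ← S_mul _ (ad (N + 1)), ip_zero]
    congr 1
    · simp
    apply S_congr; intro m
    have h : (X : A) ∣ -X ^ (2 * N + 2) := dvd_neg.2 (dvd_pow_self _ (by omega))
    rw [show (-X ^ (2 * (N + 1) + 2) : A) = -X ^ (2 * N + 2) * X ^ 2 by ring, ip_succ' h]
    have h3 := hu N
    rw [show (m + 1) ^ 2 = m ^ 2 + 2 * m + 1 by ring]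
    linear_combination - X ^ (2 * N * (m + 1) + m ^ 2 + 2 * m + 1) *
      ip (-X ^ (2 * N + 2)) (X ^ 2) (m + 1) * h3
  have hd : ∀ k N : ℕ, X ^ k ∣ G N - P N := by
    intro k
    induction k with
    | zero => simp
    | succ k ih =>
      intro N
      rw [hG, hP]
      obtain ⟨u, hu⟩ := ih (N + 1)
      refine ⟨X ^ (2 * N) * (1 + X ^ (2 * N + 2))⁻¹ * u, ?_⟩
      linear_combination X ^ (2 * N + 1) * (1 + X ^ (2 * N + 2))⁻¹ * hu
  have h0 := eq_zero_of_dvd (fun k => hd k 0)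
  simp only [G, P] at h0
  simp only [pow_zero, mul_one, mul_zero, one_pow, one_mul, zero_add] at h0
  rw [Phi]
  exact sub_eq_zero.1 h0

lemma phi_even (n : ℕ) (hn : Even n) : coeff n Phi = coeff n Phi' := by
  have h : Phi' = rescale (-1 : ℂ) Phi := by
    ext k
    rw [coeff_rescale, Phi, Phi', coeff_S, coeff_S, mul_sum]
    apply sum_congr rfl
    intro m _
    rw [← coeff_rescale, map_mul (rescale (-1 : ℂ)), map_pow]
    have hX : rescale (-1 : ℂ) X = -X := by
      simp [rescale_X]
    have h2 : rescale (-1 : ℂ) (ip (-X ^ 2) (X ^ 2) m) = ip (-X ^ 2) (X ^ 2) m := by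
      apply ip_unique X_dvd_negsq
      have := congrArg (rescale (-1 : ℂ)) (ip_mul X_dvd_negsq (X ^ 2) m)
      rw [map_mul, map_one] at this
      rw [← this]
      congr 1
      rw [poch, map_prod]
      apply prod_congr rfl; intro i _
      simp only [map_sub, map_one, map_mul, map_neg, map_pow, hX]
      ring
    rw [hX, h2, neg_pow X (m ^ 2)]
    congr 2
    rcases Nat.even_or_odd m with h | h
    · rw [h.neg_one_pow, (h.pow_of_ne_zero (by norm_num)).neg_one_pow]
    · rw [h.neg_one_pow, (h.pow).neg_one_pow]
  rw [h, coeff_rescale, hn.neg_one_pow, one_mul]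

/-- partitions with parts at most `N`, each part `i` weighted by `a i` -/
noncomputable def PG (a : ℕ → ℂ) (N : ℕ) : PowerSeries ℂ :=
  Nat.Partition.genFun (fun i c => if i ≤ N then a i ^ c else 0)

section
open scoped PowerSeries.WithPiTopology

lemma factor (c : ℂ) (i : ℕ) :
    (1 + ∑' j, c ^ (j + 1) • (X : A) ^ ((i + 1) * (j + 1))) * (1 - C c * X ^ (i + 1)) = 1 := by
  have h0 : constantCoeff (C c * X ^ (i + 1) : A) = 0 := by simp
  have h := PowerSeries.WithPiTopology.tsum_pow_mul_one_sub_of_constantCoeff_eq_zero h0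
  rw [(PowerSeries.WithPiTopology.summable_pow_of_constantCoeff_eq_zero h0).tsum_eq_zero_add] at h
  rw [← h, pow_zero]
  congr 3
  funext j
  rw [smul_eq_C_mul, map_pow]
  ring

lemma PG_mul (a : ℕ → ℂ) (N : ℕ) :
    PG a N * ∏ i ∈ range N, (1 - C (a (i + 1)) * X ^ (i + 1)) = 1 := by
  rw [PG, Nat.Partition.genFun_eq_tprod, tprod_eq_prod (s := range N), ← prod_mul_distrib]
  · apply prod_eq_one
    intro i hi
    have : i + 1 ≤ N := by simpa using hi
    simp only [if_pos this]
    exact factor _ _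
  · intro i hi
    have : ¬ (i + 1 ≤ N) := by simpa using hi
    simp [this]

lemma ones_genFun (a : ℕ → ℂ) (ha : a 1 = 0) (N w : ℕ) (hw : 1 ≤ w) (hN : 1 ≤ N) :
    Nat.Partition.genFun (fun i c => if i = 1 then (if c = w then 1 else 0) else
      if i ≤ N then a i ^ c else 0) = (1 + X ^ w) * PG a N := by
  obtain ⟨M, rfl⟩ := Nat.exists_eq_add_of_le' hN
  rw [PG, Nat.Partition.genFun_eq_tprod, Nat.Partition.genFun_eq_tprod,
    tprod_eq_prod (s := range (M + 1)), tprod_eq_prod (s := range (M + 1)), prod_range_succ',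
    prod_range_succ']
  · simp only [zero_add, ha, if_true]
    have h1 : (1 + ∑' j, (if j + 1 = w then (1 : ℂ) else 0) • (X : A) ^ (1 * (j + 1))) = 1 + X ^ w := by
      rw [tsum_eq_single (w - 1)]
      · simp [Nat.sub_add_cancel hw]
      · intro b hb
        have : b + 1 ≠ w := by omega
        simp [this]
    rw [h1]
    have h2 : (1 + ∑' j, (if (1:ℕ) ≤ M + 1 then (0 : ℂ) ^ (j + 1) else 0) •
        (X : A) ^ (1 * (j + 1))) = 1 := by
      simp
    rw [h2, mul_one, mul_comm]
    congr 1
  · intro i hi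
    have : ¬ (i + 1 ≤ M + 1) := by simpa using hi
    have : ¬ (i ≤ M) := by omega
    simp [this]
  · intro i hi
    have : ¬ (i + 1 ≤ M + 1) := by simpa using hi
    have h2 : ¬ (i ≤ M) := by omega
    have h3 : i ≠ 0 := by omega
    simp [h2, h3]

end

lemma part_prod {n : ℕ} (π : n.Partition) (f : ℕ → ℕ → ℂ) : π.parts.toFinsupp.prod f =
    ∏ i ∈ π.parts.toFinset, f i (π.parts.count i) := by
  simp [Finsupp.prod]

lemma PG_coeff (a : ℕ → ℂ) (N n : ℕ) : coeff n (PG a N) = ∑ π : n.Partition,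
    if π.parts.sup ≤ N then (π.parts.map a).prod else 0 := by
  rw [PG, Nat.Partition.coeff_genFun]
  apply sum_congr rfl
  intro π _
  rw [part_prod, Finset.prod_multiset_map_count]
  split_ifs with h
  · apply prod_congr rfl
    intro i hi
    rw [if_pos ((Multiset.le_sup (by simpa using hi)).trans h)]
  · rw [Multiset.sup_le] at h
    push Not at h
    obtain ⟨i, hi, hi'⟩ := h
    apply prod_eq_zero (i := i) (by simpa using hi)
    rw [if_neg (by omega)]

lemma sup_le_n {n : ℕ} (π : n.Partition) : π.parts.sup ≤ n := by
  rw [Multiset.sup_le]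
  intro b hb
  have := Multiset.single_le_sum (by simp) b hb
  rwa [π.parts_sum] at this

lemma sup_pos {n : ℕ} (hn : 1 ≤ n) (π : n.Partition) : 1 ≤ π.parts.sup := by
  have : π.parts ≠ 0 := by
    intro h
    have := π.parts_sum
    simp [h] at this
    omega
  obtain ⟨i, hi⟩ := Multiset.exists_mem_of_ne_zero this
  exact (π.parts_pos hi).trans_le (Multiset.le_sup hi)

lemma PG_succ (a : ℕ → ℂ) (m : ℕ) :
    PG a (m + 1) - PG a m = C (a (m + 1)) * X ^ (m + 1) * PG a (m + 1) := by
  have h1 := PG_mul a m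
  have h2 := PG_mul a (m + 1)
  rw [prod_range_succ] at h2
  linear_combination PG a m * h2 - PG a (m + 1) * (1 - C (a (m + 1)) * X ^ (m + 1)) * h1

lemma sum_sup (a : ℕ → ℂ) (z : ℂ) {n : ℕ} (hn : 1 ≤ n) :
    ∑ π : n.Partition, z ^ π.parts.sup * (π.parts.map a).prod =
    ∑ m ∈ range n, coeff n (C z ^ (m + 1) * (C (a (m + 1)) * X ^ (m + 1) * PG a (m + 1))) := by
  simp_rw [← PG_succ, ← map_pow, coeff_C_mul, map_sub, PG_coeff, ← sum_sub_distrib, mul_sum]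
  rw [sum_comm]
  apply sum_congr rfl
  intro π _
  have h1 := sup_pos hn π
  have h2 := sup_le_n π
  rw [sum_eq_single (π.parts.sup - 1)]
  · rw [Nat.sub_add_cancel h1, if_pos le_rfl, if_neg (by omega), sub_zero]
  · intro m _ hm
    by_cases h : π.parts.sup ≤ m
    · rw [if_pos h, if_pos (by omega), sub_self, mul_zero]
    · rw [if_neg h, if_neg (by omega), sub_self, mul_zero]
  · intro h
    simp at h
    omega

theorem rank_gf (y z : ℂ) {n : ℕ} (hn : 1 ≤ n) :
    ∑ π : n.Partition, z ^ π.parts.sup * y ^ π.parts.card =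
    coeff n (1 - C y + C y * F (C y) (C z * X)) := by
  have h := sum_sup (fun _ => y) z hn
  simp only [Multiset.map_const', Multiset.prod_replicate] at h
  rw [h]
  have hd : (X : A) ∣ C y * X := Dvd.dvd.mul_left dvd_rfl _
  have hd' : (X : A) ∣ C z * X := Dvd.dvd.mul_left dvd_rfl _
  have hPG : ∀ m, PG (fun _ => y) m = ip (C y * X) X m := by
    intro m
    apply ip_unique hd
    rw [← PG_mul (fun _ => y) m, mul_comm]
    congr 1
    apply prod_congr rfl; intros; ring
  have e1 : (1 - C y + C y * F (C y) (C z * X) : A) =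
      1 + S fun m => C y * ((C z * X) ^ (m + 1) * ip (C y * X) X (m + 1)) := by
    rw [S_mul _ (Adm_shift (Adm_pow hd' _)), F, S_succ (Adm_pow hd' _), ip_zero]
    ring
  rw [e1, map_add, coeff_S, coeff_one, if_neg (by omega), zero_add, sum_range_succ]
  have e2 : coeff n (C y * ((C z * X) ^ (n + 1) * ip (C y * X) X (n + 1)) : A) = 0 := by
    refine (X_pow_dvd_iff (n := n + 1)).1 ?_ n (by omega)
    rw [mul_pow]
    exact ⟨C y * (C z ^ (n + 1) * ip (C y * X) X (n + 1)), by ring⟩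
  rw [e2, add_zero]
  apply sum_congr rfl
  intro m _
  rw [hPG]
  congr 1
  ring

lemma filter_prod (a : ℕ → ℂ) (s : Multiset ℕ) :
    ((s.filter (· ≠ 1)).map a).prod = ∏ i ∈ s.toFinset, if i = 1 then 1 else a i ^ s.count i := by
  rw [Finset.prod_multiset_map_count]
  rw [Multiset.toFinset_filter, prod_filter]
  apply prod_congr rfl
  intro i _
  by_cases h : i = 1
  · simp [h]
  · simp [h]

lemma ones_sum (a : ℕ → ℂ) (ha : a 1 = 0) (n w : ℕ) (hw : 1 ≤ w) (hn : 1 ≤ n) :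
    ∑ π : n.Partition, (if π.parts.count 1 = w then ((π.parts.filter (· ≠ 1)).map a).prod else 0) =
    coeff n (X ^ w * PG a n) := by
  have h := congrArg (coeff n) (ones_genFun a ha n w hw hn)
  rw [add_mul, one_mul, map_add, Nat.Partition.coeff_genFun] at h
  rw [← sub_eq_iff_eq_add'] at h
  rw [← h, PG_coeff, ← sum_sub_distrib]
  apply sum_congr rfl
  intro π _
  rw [if_pos (sup_le_n π), part_prod, filter_prod, Finset.prod_multiset_map_count]
  by_cases h1 : 1 ∈ π.parts
  · have h1' : 1 ∈ π.parts.toFinset := by simpa using h1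
    have hc : π.parts.count 1 ≠ 0 := by simpa using h1
    rw [prod_eq_zero (s := π.parts.toFinset) (f := fun m => a m ^ π.parts.count m) h1'
      (by simp [ha, hc]), sub_zero]
    by_cases h2 : π.parts.count 1 = w
    · rw [if_pos h2]
      apply prod_congr rfl
      intro i hi
      have : i ≤ n := (Multiset.le_sup (by simpa using hi)).trans (sup_le_n π)
      by_cases h3 : i = 1
      · subst h3; simp [h2]
      · simp [h3, this]
    · rw [if_neg h2]
      symm
      apply prod_eq_zero h1'
      simp [h2]
  · have hc : π.parts.count 1 = 0 := by simpa using h1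
    rw [if_neg (by omega), eq_comm, sub_eq_zero]
    apply prod_congr rfl
    intro i hi
    have hi' : i ∈ π.parts := by simpa using hi
    have : i ≤ n := (Multiset.le_sup (by simpa using hi)).trans (sup_le_n π)
    have h3 : i ≠ 1 := by rintro rfl; exact h1 hi'
    simp [h3, this]

/-- weights for the crank -/
noncomputable def aw (z : ℂ) (w i : ℕ) : ℂ := if i = 1 then 0 else if w < i then z else 1

lemma aw_prod (z : ℂ) (w : ℕ) (hw : 1 ≤ w) (s : Multiset ℕ) :
    ((s.filter (· ≠ 1)).map (aw z w)).prod = z ^ (s.filter (fun x => w < x)).card := by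
  induction s using Multiset.induction with
  | empty => simp
  | cons i s ih =>
    by_cases h : i = 1
    · subst h
      rw [Multiset.filter_cons_of_neg (p := fun x => x ≠ 1) _ (by simp), ih, Multiset.filter_cons_of_neg _ (by omega)]
    · rw [Multiset.filter_cons_of_pos (p := fun x => x ≠ 1) _ h, Multiset.map_cons, Multiset.prod_cons, ih, aw, if_neg h]
      by_cases h2 : w < i
      · rw [if_pos h2, Multiset.filter_cons_of_pos _ h2, Multiset.card_cons, pow_succ']
      · rw [if_neg h2, Multiset.filter_cons_of_neg _ h2, one_mul]

lemma aw_small (z : ℂ) (w : ℕ) (hw : 1 ≤ w) :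
    (1 - X) * ∏ i ∈ range w, (1 - C (aw z w (i + 1)) * X ^ (i + 1)) = poch (X : A) X w := by
  obtain ⟨v, rfl⟩ := Nat.exists_eq_add_of_le' hw
  rw [prod_range_succ', poch_succ', poch]
  simp only [zero_add, aw, if_true, map_zero, zero_mul, sub_zero, mul_one]
  congr 1
  apply prod_congr rfl
  intro i hi
  have : i < v := by simpa using hi
  rw [if_neg (by omega), if_neg (by omega), map_one]
  ring

lemma aw_PG (z : ℂ) (w n : ℕ) (hw : 1 ≤ w) (hn : w ≤ n) :
    (1 - X) * r X w * E X (C z * X ^ (w + 1)) = PG (aw z w) n * E X (C z * X ^ (n + 1)) := by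
  obtain ⟨d, rfl⟩ := Nat.exists_eq_add_of_le hn
  have hd : (X : A) ∣ C z * X ^ (w + 1) := Dvd.dvd.mul_left (dvd_pow_self _ (by omega)) _
  have h1 := E_shift_n (p := X) dvd_rfl hd d
  have h2 := PG_mul (aw z w) (w + d)
  rw [prod_range_add] at h2
  have h3 : ∏ x ∈ range d, (1 - C (aw z w (w + x + 1)) * X ^ (w + x + 1)) =
      poch (C z * X ^ (w + 1) : A) X d := by
    apply prod_congr rfl
    intro i _
    rw [aw, if_neg (by omega), if_pos (by omega)]
    ring
  have h4 := aw_small z w hw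
  have h5 := ip_mul (dvd_refl (X : A)) X w
  rw [h3] at h2
  rw [show (C z * X ^ (w + d + 1) : A) = C z * X ^ (w + 1) * X ^ d by ring, h1, r]
  rw [← h4] at h5
  linear_combination - (1 - X) * ip X X w * E X (C z * X ^ (w + 1)) * h2
    + PG (aw z w) (w + d) * poch (C z * X ^ (w + 1)) X d * E X (C z * X ^ (w + 1)) * h5

lemma coeff_aw (z : ℂ) (w n : ℕ) (hw : 1 ≤ w) (hn : w ≤ n) :
    coeff n (X ^ w * ((1 - X) * r X w * E X (C z * X ^ (w + 1)))) =
    coeff n (X ^ w * PG (aw z w) n) := by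
  rw [aw_PG z w n hw hn, ← sub_eq_zero, ← map_sub]
  have hd : (X : A) ∣ C z * X ^ (n + 1) := Dvd.dvd.mul_left (dvd_pow_self _ (by omega)) _
  obtain ⟨u, hu⟩ := E_sub_one (p := X) hd
  refine (X_pow_dvd_iff (n := n + 1)).1 ?_ n (by omega)
  exact ⟨X ^ w * PG (aw z w) n * C z * u, by linear_combination X ^ w * PG (aw z w) n * hu⟩

lemma noones_prod {n : ℕ} (z : ℂ) (π : n.Partition) :
    (π.parts.map (aw 1 1)).prod = if π.parts.count 1 = 0 then 1 else 0 := by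
  by_cases h : 1 ∈ π.parts
  · rw [if_neg (by simpa using h)]
    apply Multiset.prod_eq_zero
    rw [Multiset.mem_map]
    exact ⟨1, h, by simp [aw]⟩
  · rw [if_pos (by simpa using h)]
    apply Multiset.prod_eq_one
    intro x hx
    obtain ⟨i, hi, rfl⟩ := Multiset.mem_map.1 hx
    have : i ≠ 1 := by rintro rfl; exact h hi
    simp [aw, this]

lemma noones_gf (z : ℂ) {n : ℕ} (hn : 2 ≤ n) :
    ∑ π : n.Partition, (if π.parts.count 1 = 0 then z ^ π.parts.sup else 0) =
    coeff n ((1 - X) * E X (C z * X)) := by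
  have h := sum_sup (aw 1 1) z (show 1 ≤ n by omega)
  simp only [noones_prod z, mul_ite, mul_one, mul_zero] at h
  rw [h]
  have hd' : (X : A) ∣ C z * X := Dvd.dvd.mul_left dvd_rfl _
  have hPG : ∀ m, PG (aw 1 1) (m + 1) = (1 - X) * r X (m + 1) := by
    intro m
    have h1 := PG_mul (aw 1 1) (m + 1)
    have h2 : (1 - X) * ∏ i ∈ range (m + 1), (1 - C (aw 1 1 (i + 1)) * X ^ (i + 1)) =
        poch (X : A) X (m + 1) := by
      rw [← aw_small 1 (m + 1) (by omega)]
      congr 1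
      apply prod_congr rfl
      intro i _
      simp [aw]
    have h3 := ip_mul (dvd_refl (X : A)) X (m + 1)
    rw [← h2] at h3
    rw [r]
    linear_combination (1 - X) * ip X X (m + 1) * h1 - PG (aw 1 1) (m + 1) * h3
  have e1 : (1 - X) * E X (C z * X) = (1 - X : A) +
      S fun m => (1 - X) * ((C z * X) ^ (m + 1) * r X (m + 1)) := by
    rw [S_mul _ (Adm_shift (Adm_pow hd' _)), E_eq hd']
    ring
  have e0 : coeff n (1 - X : A) = 0 := by
    rw [map_sub, coeff_one, coeff_X, if_neg (by omega), if_neg (by omega), sub_zero]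
  rw [e1, map_add, coeff_S, e0, zero_add, sum_range_succ]
  have e2 : coeff n ((1 - X) * ((C z * X) ^ (n + 1) * r X (n + 1)) : A) = 0 := by
    refine (X_pow_dvd_iff (n := n + 1)).1 ?_ n (by omega)
    rw [mul_pow]
    exact ⟨(1 - X) * (C z ^ (n + 1) * r X (n + 1)), by ring⟩
  rw [e2, add_zero]
  apply sum_congr rfl
  intro m _
  rw [hPG]
  rcases Nat.eq_zero_or_pos m with rfl | hm
  · have h3 := r_succ (dvd_refl (X : A)) 0
    rw [r, ip_zero, zero_add, pow_one] at h3
    have : (1 - X) * ((C z * X) ^ (0 + 1) * r X (0 + 1)) = (C z * X : A) := by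
      simp only [zero_add, pow_one]
      linear_combination - C z * X * h3
    rw [this, coeff_C_mul, coeff_X, if_neg (by omega)]
    simp [aw]
  · congr 1
    have : aw 1 1 (m + 1) = 1 := by simp [aw]; omega
    rw [this, map_one]
    ring

theorem crank_gf (y z : ℂ) (hyz : z * y = 1) {n : ℕ} (hn : 2 ≤ n) :
    ∑ π : n.Partition, z ^ partitionCrank π = coeff n ((1 - X) * U y z) := by
  have hz : z ≠ 0 := left_ne_zero_of_mul_eq_one hyz
  have hy : y = z⁻¹ := eq_inv_of_mul_eq_one_right hyz
  rw [U_eq, ← S_mul _ (Adm_pow (Dvd.dvd.mul_left dvd_rfl _) _), coeff_S, sum_range_succ']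
  have h0 : ((1 - X) * ((C y * X) ^ 0 * (r X 0 * E X (C z * X ^ (0 + 1)))) : A) =
      (1 - X) * E X (C z * X) := by
    simp [r, ip_zero]
  rw [h0, ← noones_gf z hn]
  have hw : ∀ w ∈ range n, coeff n ((1 - X) * ((C y * X) ^ (w + 1) *
      (r X (w + 1) * E X (C z * X ^ (w + 1 + 1)))) : A) =
      ∑ π : n.Partition, if π.parts.count 1 = w + 1 then z ^ partitionCrank π else 0 := by
    intro w hw
    have hw' : w < n := by simpa using hw
    rw [show ((1 - X) * ((C y * X) ^ (w + 1) * (r X (w + 1) * E X (C z * X ^ (w + 1 + 1)))) : A) =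
      C (y ^ (w + 1)) * (X ^ (w + 1) * ((1 - X) * r X (w + 1) * E X (C z * X ^ (w + 1 + 1)))) by
      rw [map_pow]; ring, coeff_C_mul, coeff_aw z (w + 1) n (by omega) (by omega),
      ← ones_sum _ (by simp [aw]) n (w + 1) (by omega) (by omega), mul_sum]
    apply sum_congr rfl
    intro π _
    split_ifs with h
    · rw [aw_prod z _ (by omega), partitionCrank, if_neg (by omega), h, zpow_sub₀ hz, hy, zpow_natCast, zpow_natCast, inv_pow,
        div_eq_mul_inv, mul_comm]
    · simp
  rw [sum_congr rfl hw, sum_comm, ← sum_add_distrib]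
  apply sum_congr rfl
  intro π _
  by_cases h : π.parts.count 1 = 0
  · rw [if_pos h, sum_eq_zero]
    · rw [partitionCrank, if_pos h]; simp
    · intro w _
      rw [if_neg (by omega)]
  · have hc : π.parts.count 1 ≤ n := by
      have h1 := Multiset.count_le_card 1 π.parts
      have h2 : π.parts.card ≤ π.parts.sum := by
        have := Multiset.card_nsmul_le_sum (s := π.parts) (a := 1) (fun x hx => π.parts_pos hx)
        simpa using this
      rw [π.parts_sum] at h2
      omega
    rw [if_neg h, add_zero, sum_eq_single (π.parts.count 1 - 1)]
    · rw [if_pos (by omega)]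
    · intro w _ hw
      rw [if_neg (by omega)]
    · intro h'
      simp at h'
      omega

lemma filter_crank (c : ℤ) : (4 : ℂ) * (if c % (4 : ℕ) = 1 % (4 : ℕ) then 1 else 0) =
    1 - (-1) ^ c - Complex.I * (Complex.I ^ c - (-Complex.I) ^ c) := by
  have hI : Complex.I ≠ 0 := Complex.I_ne_zero
  have hn : (-Complex.I) ≠ 0 := neg_ne_zero.2 hI
  obtain ⟨k, j, hj0, hj, rfl⟩ : ∃ k j : ℤ, 0 ≤ j ∧ j < 4 ∧ c = 4 * k + j :=
    ⟨c / 4, c % 4, by omega, by omega, by omega⟩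
  have a1 : Complex.I ^ (4 * k) = 1 := by
    rw [zpow_mul, show Complex.I ^ (4 : ℤ) = 1 from by exact_mod_cast Complex.I_pow_four, one_zpow]
  have a2 : (-Complex.I) ^ (4 * k) = 1 := by
    rw [Even.neg_zpow ⟨2 * k, by ring⟩, a1]
  have a3 : (-1 : ℂ) ^ (4 * k) = 1 := by
    rw [Even.neg_zpow ⟨2 * k, by ring⟩, one_zpow]
  rw [zpow_add₀ hI, zpow_add₀ hn, zpow_add₀ (by norm_num), a1, a2, a3]
  have hII := Complex.I_mul_I
  have e2 : ∀ x : ℂ, x ^ (2 : ℤ) = x * x := fun x => by rw [zpow_two]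
  have e3 : ∀ x : ℂ, x ^ (3 : ℤ) = x * x * x := fun x => by
    rw [show (3 : ℤ) = (3 : ℕ) by rfl, zpow_natCast]; ring
  have hdec : ∀ j : ℤ, (4 * k + j) % ((4 : ℕ) : ℤ) = j % 4 := by intro j; push_cast; omega
  rw [hdec]
  interval_cases j
  · norm_num
  · norm_num
    linear_combination 2 * hII
  · norm_num [e2]
  · norm_num [e3]
    linear_combination -2 * hII

lemma filter_rank (c : ℤ) : (4 : ℂ) * (if c % (4 : ℕ) = 2 % (4 : ℕ) then 1 else 0) =
    1 + (-1) ^ c - Complex.I ^ c - (-Complex.I) ^ c := by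
  have hI : Complex.I ≠ 0 := Complex.I_ne_zero
  have hn : (-Complex.I) ≠ 0 := neg_ne_zero.2 hI
  obtain ⟨k, j, hj0, hj, rfl⟩ : ∃ k j : ℤ, 0 ≤ j ∧ j < 4 ∧ c = 4 * k + j :=
    ⟨c / 4, c % 4, by omega, by omega, by omega⟩
  have a1 : Complex.I ^ (4 * k) = 1 := by
    rw [zpow_mul, show Complex.I ^ (4 : ℤ) = 1 from by exact_mod_cast Complex.I_pow_four, one_zpow]
  have a2 : (-Complex.I) ^ (4 * k) = 1 := by
    rw [Even.neg_zpow ⟨2 * k, by ring⟩, a1]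
  have a3 : (-1 : ℂ) ^ (4 * k) = 1 := by
    rw [Even.neg_zpow ⟨2 * k, by ring⟩, one_zpow]
  rw [zpow_add₀ hI, zpow_add₀ hn, zpow_add₀ (by norm_num), a1, a2, a3]
  have hII := Complex.I_mul_I
  have e2 : ∀ x : ℂ, x ^ (2 : ℤ) = x * x := fun x => by rw [zpow_two]
  have e3 : ∀ x : ℂ, x ^ (3 : ℤ) = x * x * x := fun x => by
    rw [show (3 : ℤ) = (3 : ℕ) by rfl, zpow_natCast]; ring
  have hdec : ∀ j : ℤ, (4 * k + j) % ((4 : ℕ) : ℤ) = j % 4 := by intro j; push_cast; omega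
  rw [hdec]
  interval_cases j
  · norm_num
  · norm_num
  · norm_num [e2]
  · norm_num [e3]

lemma rank_gf' (y z : ℂ) (hyz : z * y = 1) {n : ℕ} (hn : 1 ≤ n) :
    ∑ π : n.Partition, z ^ partitionRank π =
    coeff n (1 - C y + C y * F (C y) (C z * X)) := by
  have hz : z ≠ 0 := left_ne_zero_of_mul_eq_one hyz
  have hy : y = z⁻¹ := eq_inv_of_mul_eq_one_right hyz
  rw [← rank_gf y z hn]
  apply sum_congr rfl
  intro π _
  rw [partitionRank, zpow_sub₀ hz, hy]
  simp [div_eq_mul_inv]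

end RC

open RC in
theorem stmt_12 : ∀ n : ℕ, 1 ≤ n → rankCount 2 4 (2 * n) = crankCount 1 4 (2 * n) := by
  intro n hn
  have hII := Complex.I_mul_I
  have hC : (4 : ℂ) * crankCount 1 4 (2 * n) = ∑ π : (2 * n).Partition,
      (1 - (-1) ^ partitionCrank π - Complex.I * (Complex.I ^ partitionCrank π
        - (-Complex.I) ^ partitionCrank π)) := by
    rw [crankCount, Finset.card_filter]
    push_cast
    rw [Finset.mul_sum]
    exact Finset.sum_congr rfl fun π _ => by exact_mod_cast filter_crank (partitionCrank π)
  have hR : (4 : ℂ) * rankCount 2 4 (2 * n) = ∑ π : (2 * n).Partition,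
      (1 + (-1) ^ partitionRank π - Complex.I ^ partitionRank π
        - (-Complex.I) ^ partitionRank π) := by
    rw [rankCount, Finset.card_filter]
    push_cast
    rw [Finset.mul_sum]
    exact Finset.sum_congr rfl fun π _ => by exact_mod_cast filter_rank (partitionRank π)
  simp only [Finset.sum_sub_distrib, Finset.sum_add_distrib, ← Finset.mul_sum] at hC hR
  have hn2 : 2 ≤ 2 * n := by omega
  have hn1 : 1 ≤ 2 * n := by omega
  rw [crank_gf (-1) (-1) (by norm_num) hn2,
    crank_gf (-Complex.I) Complex.I (by rw [mul_neg, hII]; norm_num) hn2,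
    crank_gf Complex.I (-Complex.I) (by rw [neg_mul, hII]; norm_num) hn2, U_symm (-Complex.I),
    sub_self, mul_zero, sub_zero] at hC
  have f1 := fine Complex.I hII
  have f2 := fine (-Complex.I) (by rw [neg_mul_neg, hII])
  rw [neg_neg] at f2
  rw [rank_gf' (-1) (-1) (by norm_num) hn1,
    rank_gf' (-Complex.I) Complex.I (by rw [mul_neg, hII]; norm_num) hn1,
    rank_gf' Complex.I (-Complex.I) (by rw [neg_mul, hII]; norm_num) hn1, f1, f2,
    phi_even _ (even_two_mul n)] at hR
  have hw := congrArg (PowerSeries.coeff (2 * n)) watson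
  have h1 : PowerSeries.coeff (2 * n) (1 : PowerSeries ℂ) = 0 := by
    rw [PowerSeries.coeff_one, if_neg (by omega)]
  have h2 : (2 * (1 - Phi') : PowerSeries ℂ) = (1 - Phi') + (1 - Phi') := by ring
  have h3 : (1 - PowerSeries.C (-1) + PowerSeries.C (-1) *
      F (PowerSeries.C (-1)) (PowerSeries.C (-1) * PowerSeries.X) : PowerSeries ℂ) =
      1 + 1 - F (-1) (-PowerSeries.X) := by
    rw [show (PowerSeries.C (-1 : ℂ) : PowerSeries ℂ) = -1 by simp, neg_one_mul, neg_one_mul]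
    ring
  rw [h3, map_sub, map_add, h1] at hR
  rw [h2] at hw
  simp only [map_sub, map_add, h1] at hw
  have : (4 : ℂ) * rankCount 2 4 (2 * n) = 4 * crankCount 1 4 (2 * n) := by
    rw [hC, hR]
    linear_combination -hw
  have h4 : (rankCount 2 4 (2 * n) : ℂ) = crankCount 1 4 (2 * n) :=
    mul_left_cancel₀ (by norm_num) this
  exact_mod_cast h4
end

section
/- For every integer n ≥ 1: N(0,4;2n+1) = C(1,4;2n+1). -/
open Finset in
theorem pf_prod {A : Type*} [CommRing A] (q : A) (N : ℕ) (hq : q ^ N = 0) (f : ℕ → ℕ → A) :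
    ∑ n ∈ range N, (∑ π : n.Partition, ∏ i ∈ range N, f i (π.parts.count (i + 1))) * q ^ n
      = ∏ i ∈ range N, ∑ j ∈ range N, f i j * q ^ ((i + 1) * j) := by
  have hsum : ∀ (n : ℕ) (π : n.Partition), n < N →
      ∑ i : Fin N, ((i : ℕ) + 1) * π.parts.count ((i : ℕ) + 1) = n := by
    intro n π hn
    have h1 : π.parts.sum = n := π.parts_sum
    rw [Finset.sum_multiset_count] at h1
    rw [Fin.sum_univ_eq_sum_range (fun i => (i + 1) * π.parts.count (i + 1))]
    have h2 : ∑ i ∈ range (N + 1), i * π.parts.count i = n := by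
      refine Eq.trans ?_ h1
      symm
      rw [Finset.sum_congr rfl (fun i _ => by rw [smul_eq_mul, mul_comm])]
      apply Finset.sum_subset
      · intro x hx
        have := π.le_of_mem_parts (Multiset.mem_toFinset.1 hx)
        simp; omega
      · intro x _ hx
        rw [Multiset.mem_toFinset] at hx
        simp [hx]
    rw [Finset.sum_range_succ'] at h2
    simpa using h2
  rw [Finset.prod_range (fun i => ∑ j ∈ range N, f i j * q ^ ((i + 1) * j)), Finset.prod_univ_sum]
  simp_rw [Finset.sum_mul]
  rw [Finset.sum_sigma']
  refine Finset.sum_of_injOn (fun x => fun i : Fin N => x.2.parts.count ((i : ℕ) + 1)) ?_ ?_ ?_ ?_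
  · rintro ⟨n, π⟩ hx ⟨m, ρ⟩ hy hxy
    simp only [coe_sigma, Set.mem_sigma_iff, coe_range, Set.mem_Iio, coe_univ, Set.mem_univ, and_true] at hx hy
    simp only at hxy
    have hnm : n = m := by
      rw [← hsum n π hx, ← hsum m ρ hy]
      exact Finset.sum_congr rfl (fun i _ => by rw [congrFun hxy i])
    subst hnm
    have : π = ρ := by
      apply Nat.Partition.ext
      ext a
      rcases Nat.eq_zero_or_pos a with rfl | ha
      · rw [Multiset.count_eq_zero_of_notMem, Multiset.count_eq_zero_of_notMem]
        · intro h; exact absurd (ρ.parts_pos h) (lt_irrefl _)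
        · intro h; exact absurd (π.parts_pos h) (lt_irrefl _)
      · by_cases haN : a ≤ N
        · have := congrFun hxy ⟨a - 1, by omega⟩
          simpa [Nat.sub_add_cancel ha] using this
        · rw [Multiset.count_eq_zero_of_notMem, Multiset.count_eq_zero_of_notMem]
          · intro h; have := ρ.le_of_mem_parts h; omega
          · intro h; have := π.le_of_mem_parts h; omega
    rw [this]
  · rintro ⟨n, π⟩ hx
    simp only [coe_sigma, Set.mem_sigma_iff, coe_range, Set.mem_Iio, coe_univ, Set.mem_univ, and_true] at hx
    simp only [Fintype.coe_piFinset, Set.mem_pi, coe_range, Set.mem_Iio, Set.mem_univ, true_implies]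
    intro i
    have h := hsum n π hx
    have h2 := Finset.single_le_sum (f := fun i : Fin N => ((i : ℕ) + 1) * π.parts.count ((i : ℕ) + 1)) (fun _ _ => Nat.zero_le _) (Finset.mem_univ i)
    simp only [h] at h2
    nlinarith [Nat.zero_le ((i : ℕ) * π.parts.count ((i : ℕ) + 1))]
  · intro p hp hnot
    rw [Finset.prod_mul_distrib, Finset.prod_pow_eq_pow_sum]
    by_cases hlt : ∑ i : Fin N, ((i : ℕ) + 1) * p i < N
    · exfalso
      apply hnot
      have hs : (∑ i : Fin N, Multiset.replicate (p i) ((i : ℕ) + 1)).sum = ∑ i : Fin N, ((i : ℕ) + 1) * p i := by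
        rw [← Multiset.coe_sumAddMonoidHom, map_sum]
        simp [mul_comm]
      refine ⟨⟨∑ i : Fin N, ((i : ℕ) + 1) * p i,
        ⟨∑ i : Fin N, Multiset.replicate (p i) ((i : ℕ) + 1), ?_, hs⟩⟩, ?_, ?_⟩
      · intro a ha
        rw [Multiset.mem_sum] at ha
        obtain ⟨i, _, hi⟩ := ha
        have := Multiset.eq_of_mem_replicate hi
        omega
      · simpa using hlt
      · funext k
        simp only [Multiset.count_sum', Multiset.count_replicate]
        rw [Finset.sum_eq_single k]
        · simp
        · intro b _ hb
          rw [if_neg]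
          intro h; apply hb; ext; omega
        · simp
    · rw [pow_eq_zero_of_le (not_lt.1 hlt) hq, mul_zero]
  · rintro ⟨n, π⟩ hx
    simp only [mem_sigma, mem_range, mem_univ, and_true] at hx
    rw [Finset.prod_mul_distrib, Finset.prod_pow_eq_pow_sum, hsum n π hx, Finset.prod_range]

open Finset

section qalg
variable {A : Type*} [CommRing A]

/-- inverse of `1 - c q^k`. -/
def gInv (q : A) (N : ℕ) (c : A) (k : ℕ) : A := ∑ j ∈ range N, (c * q ^ k) ^ j

theorem gInv_mul {q : A} {N : ℕ} (hq : q ^ N = 0) (c : A) {k : ℕ} (hk : 1 ≤ k) :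
    (1 - c * q ^ k) * gInv q N c k = 1 := by
  unfold gInv
  rw [mul_neg_geom_sum, mul_pow, ← pow_mul, pow_eq_zero_of_le _ hq]
  · simp
  · nlinarith

theorem cancel_one_sub {q : A} {N : ℕ} (hq : q ^ N = 0) (c : A) {k : ℕ} (hk : 1 ≤ k) {x y : A}
    (h : (1 - c * q ^ k) * x = (1 - c * q ^ k) * y) : x = y := by
  have h1 := gInv_mul hq c hk
  linear_combination (gInv q N c k) * h - (x - y) * h1

/-- `(cq;q)_n` inverse. -/
def iP (q : A) (N : ℕ) (c : A) (n : ℕ) : A := ∏ k ∈ range n, gInv q N c (k + 1)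

/-- `(cq^(m+1);q)_∞`. -/
def tP (q : A) (N : ℕ) (c : A) (m : ℕ) : A := ∏ k ∈ Ico m N, (1 - c * q ^ (k + 1))

theorem tP_succ {q : A} {N : ℕ} (hq : q ^ N = 0) (c : A) (m : ℕ) :
    tP q N c m = (1 - c * q ^ (m + 1)) * tP q N c (m + 1) := by
  unfold tP
  rcases lt_or_ge m N with h | h
  · rw [Finset.prod_eq_prod_Ico_succ_bot h]
  · rw [Finset.Ico_eq_empty (by omega), Finset.Ico_eq_empty (by omega),
      pow_eq_zero_of_le (by omega) hq]
    simp

theorem tP_top {q : A} {N : ℕ} (c : A) {m : ℕ} (hm : N ≤ m) : tP q N c m = 1 := by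
  unfold tP
  rw [Finset.Ico_eq_empty (by omega)]; simp

theorem iP_mul_tP {q : A} {N : ℕ} (hq : q ^ N = 0) (c : A) (n : ℕ) :
    iP q N c n * tP q N c 0 = tP q N c n := by
  induction n with
  | zero => simp [iP]
  | succ n ih =>
    have h1 := tP_succ hq c n
    have h2 := gInv_mul hq c (k := n + 1) (by omega)
    have h3 : iP q N c (n + 1) = iP q N c n * gInv q N c (n + 1) := by
      simp [iP, Finset.prod_range_succ]
    rw [h3]
    linear_combination (gInv q N c (n+1)) * ih + (gInv q N c (n+1)) * h1 + tP q N c (n+1) * h2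

theorem cancel_tP {q : A} {N : ℕ} (hq : q ^ N = 0) (c : A) {x y : A}
    (h : x * tP q N c 0 = y * tP q N c 0) : x = y := by
  have h1 := iP_mul_tP hq c N
  rw [tP_top c le_rfl] at h1
  linear_combination (iP q N c N) * h - (x - y) * h1

/-! q-binomial -/
def gB (q : A) (N : ℕ) (a c : A) (j : ℕ) : A :=
  ∑ k ∈ range N, (∏ i ∈ range k, (1 - a * q ^ i)) * c ^ k * q ^ (j * k) * iP q N 1 k

theorem gB_step {q : A} {N : ℕ} (hq : q ^ N = 0) (a c : A) {j : ℕ} (hj : 1 ≤ j) :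
    (1 - c * q ^ j) * gB q N a c j = (1 - a * c * q ^ j) * gB q N a c (j + 1) := by
  have hS : ∀ J, 1 ≤ J → gB q N a c J =
     ∑ k ∈ range (N + 1), (∏ i ∈ range k, (1 - a * q ^ i)) * c ^ k * q ^ (J * k) * iP q N 1 k := by
    intro J hJ
    rw [Finset.sum_range_succ, pow_eq_zero_of_le (show N ≤ J * N by nlinarith) hq]
    simp [gB]
  have key : gB q N a c j - gB q N a c (j + 1) =
      c * q ^ j * (gB q N a c j - a * gB q N a c (j + 1)) := by
    conv_lhs => rw [hS j hj, hS (j + 1) (by omega)]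
    rw [← Finset.sum_sub_distrib, Finset.sum_range_succ']
    simp only [gB, mul_zero, pow_zero, sub_self, add_zero, Finset.mul_sum, ← Finset.sum_sub_distrib]
    apply Finset.sum_congr rfl
    intro k _
    have h3 : iP q N 1 (k + 1) = iP q N 1 k * gInv q N 1 (k + 1) := by
      simp [iP, Finset.prod_range_succ]
    have h2 := gInv_mul hq 1 (k := k + 1) (by omega)
    rw [h3, Finset.prod_range_succ]
    have e1 : q ^ (j * (k + 1)) = q ^ j * q ^ (j * k) := by ring
    have e2 : q ^ ((j + 1) * (k + 1)) = q ^ j * q ^ (j * k) * q ^ (k + 1) := by ring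
    have e3 : q ^ ((j + 1) * k) = q ^ (j * k) * q ^ k := by ring
    rw [e1, e2, e3]
    linear_combination ((∏ i ∈ range k, (1 - a * q ^ i)) * (1 - a * q ^ k) * c ^ (k + 1) * q ^ j * q ^ (j * k) * iP q N 1 k) * h2
  linear_combination key

theorem gB_top {q : A} {N : ℕ} (hq : q ^ N = 0) (hN : 1 ≤ N) (a c : A) {j : ℕ} (hj : N ≤ j) :
    gB q N a c j = 1 := by
  unfold gB
  rw [Finset.sum_eq_single 0]
  · simp [iP]
  · intro k _ hk
    rw [pow_eq_zero_of_le (show N ≤ j * k by have : 1 ≤ k := by omega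
                                             nlinarith) hq]
    simp
  · intro h; simp at h; omega

theorem gB_prod {q : A} {N : ℕ} (hq : q ^ N = 0) (hN : 1 ≤ N) (a c : A) :
    gB q N a c 1 * tP q N c 0 = tP q N (a * c) 0 := by
  have : ∀ J, gB q N a c 1 * ∏ k ∈ range J, (1 - c * q ^ (k + 1)) =
      (∏ k ∈ range J, (1 - a * c * q ^ (k + 1))) * gB q N a c (J + 1) := by
    intro J
    induction J with
    | zero => simp
    | succ J ih =>
      rw [Finset.prod_range_succ, Finset.prod_range_succ]
      have := gB_step hq a c (j := J + 1) (by omega)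
      linear_combination (1 - c * q ^ (J + 1)) * ih + (∏ k ∈ range J, (1 - a * c * q ^ (k + 1))) * this
  have h := this N
  rw [gB_top hq hN a c (j := N + 1) (by omega)] at h
  simpa [tP, ← Finset.range_eq_Ico] using h

/-! Gauss -/
def xG (q : A) (N : ℕ) (m : ℕ) : A :=
  ∑ k ∈ range N, (∏ i ∈ range k, (1 + q ^ (m + 1 + i))) * (-1) ^ k * q ^ ((m + 1) * k) *
    ∏ i ∈ range k, gInv q N 1 (m + 1 + i)

theorem xG_step {q : A} {N : ℕ} (hq : q ^ N = 0) (m : ℕ) :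
    (1 - q ^ (m + 1)) * xG q N m =
      (1 - q ^ (m + 1)) ^ 2 - q ^ (2 * m + 2) * ((1 - q ^ (m + 2)) * xG q N (m + 1)) := by
  set u : ℕ → A := fun k => (∏ i ∈ range k, (1 + q ^ (m + 1 + i))) * (-1) ^ k * q ^ ((m + 1) * k) *
    ∏ i ∈ range k, gInv q N 1 (m + 1 + i) with hu
  set v : ℕ → A := fun k => (∏ i ∈ range k, (1 + q ^ (m + 1 + 1 + i))) * (-1) ^ k * q ^ ((m + 1 + 1) * k) *
    ∏ i ∈ range k, gInv q N 1 (m + 1 + 1 + i) with hv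
  set x := q ^ (m + 1) with hx
  have hus : ∀ k, (1 - x * q ^ k) * u (k + 1) = - x * (1 + x * q ^ k) * u k := by
    intro k
    have h2 := gInv_mul hq 1 (k := m + 1 + k) (by omega)
    simp only [hu, Finset.prod_range_succ]
    have e1 : q ^ ((m + 1) * (k + 1)) = x * q ^ ((m + 1) * k) := by rw [hx]; ring
    have e2 : q ^ (m + 1 + k) = x * q ^ k := by rw [hx]; ring
    rw [e2] at h2
    rw [e1, e2]
    linear_combination (-(∏ i ∈ range k, (1 + q ^ (m + 1 + i))) * (1 + x * q ^ k) * (-1) ^ k * x * q ^ ((m + 1) * k) *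
      ∏ i ∈ range k, gInv q N 1 (m + 1 + i)) * h2
  have hvs : ∀ k, (1 - x * q ^ (k + 1)) * v (k + 1) = - x * q * (1 + x * q ^ (k + 1)) * v k := by
    intro k
    have h2 := gInv_mul hq 1 (k := m + 1 + 1 + k) (by omega)
    simp only [hv, Finset.prod_range_succ]
    have e1 : q ^ ((m + 1 + 1) * (k + 1)) = x * q * q ^ ((m + 1 + 1) * k) := by rw [hx]; ring
    have e2 : q ^ (m + 1 + 1 + k) = x * q ^ (k + 1) := by rw [hx]; ring
    rw [e2] at h2
    rw [e1, e2]
    linear_combination (-(∏ i ∈ range k, (1 + q ^ (m + 1 + 1 + i))) * (1 + x * q ^ (k + 1)) * (-1) ^ k * x * q * q ^ ((m + 1 + 1) * k) *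
      ∏ i ∈ range k, gInv q N 1 (m + 1 + 1 + i)) * h2
  have canc : ∀ (k : ℕ) (a b : A), (1 - x * q ^ k) * a = (1 - x * q ^ k) * b → a = b := by
    intro k a b h
    apply cancel_one_sub hq 1 (k := m + 1 + k) (by omega)
    have e2 : q ^ (m + 1 + k) = x * q ^ k := by rw [hx]; ring
    rw [e2, one_mul, h]
  have huv : ∀ k, (1 + x) * (1 - x * q ^ k) * v k = q ^ k * (1 + x * q ^ k) * (1 - x) * u k := by
    intro k
    induction k with
    | zero => simp [hu, hv]
    | succ k ih =>
      apply canc k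
      have h1 := hus k
      have h2 := hvs k
      have e : q ^ (k + 1) = q * q ^ k := by ring
      rw [e] at *
      linear_combination (1 - x * q ^ k) * (1 + x) * h2 - (q * q ^ k * (1 + x * (q * q ^ k)) * (1 - x)) * h1
        + (- x * q * (1 + x * (q * q ^ k))) * ih
  have tel : ∀ k, (1 + x) * (1 - x) * u k + x ^ 2 * (1 - x * q) * (1 + x) * v k =
      u k * (1 - x) * (1 - x ^ 2 * q ^ k) - u (k + 1) * (1 - x) * (1 - x ^ 2 * q ^ (k + 1)) := by
    intro k
    apply canc k
    have h1 := hus k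
    have h2 := huv k
    have e : q ^ (k + 1) = q * q ^ k := by ring
    rw [e]
    linear_combination (x ^ 2 * (1 - x * q)) * h2 + ((1 - x) * (1 - x ^ 2 * (q * q ^ k))) * h1
  have huN : u N = 0 := by
    simp only [hu]
    rw [pow_eq_zero_of_le (show N ≤ (m + 1) * N by nlinarith) hq]; simp
  have hsum := Finset.sum_congr (rfl : range N = range N) (fun k _ => tel k)
  rw [Finset.sum_range_sub' (fun k => u k * (1 - x) * (1 - x ^ 2 * q ^ k)), huN,
    Finset.sum_add_distrib, ← Finset.mul_sum, ← Finset.mul_sum] at hsum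
  have h0 : u 0 = 1 := by simp [hu]
  have e3 : q ^ (m + 2) = x * q := by rw [hx]; ring
  have e4 : q ^ (2 * m + 2) = x ^ 2 := by rw [hx]; ring
  have hX : xG q N m = ∑ k ∈ range N, u k := rfl
  have hX' : xG q N (m + 1) = ∑ k ∈ range N, v k := rfl
  rw [e3, e4, hX, hX']
  apply cancel_one_sub hq (-1) (k := m + 1) (by omega)
  rw [← hx]
  rw [h0] at hsum
  linear_combination hsum

theorem gauss {q : A} {N : ℕ} (hq : q ^ N = 0) :
    (1 - q) * xG q N 0 = 1 + 2 * ∑ n ∈ range N, (-1) ^ (n + 1) * q ^ ((n + 1) ^ 2) := by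
  have : ∀ J, (1 - q) * xG q N 0 = 1 + 2 * ∑ n ∈ range J, (-1) ^ (n + 1) * q ^ ((n + 1) ^ 2)
      + (-1) ^ J * q ^ (J * (J + 1)) * ((1 - q ^ (J + 1)) * xG q N J - 1) := by
    intro J
    induction J with
    | zero => simp
    | succ J ih =>
      rw [ih, Finset.sum_range_succ, xG_step hq J]
      ring
  rw [this N, pow_eq_zero_of_le (show N ≤ N * (N + 1) by nlinarith) hq]
  ring
end qalg

section qalg2
variable {A : Type*} [CommRing A]

theorem down_unique {F G c : ℕ → A} (N : ℕ) (hF : ∀ m, F m = c m * F (m + 1))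
    (hG : ∀ m, G m = c m * G (m + 1)) (hN : F N = G N) (m : ℕ) (hm : m ≤ N) : F m = G m := by
  induction hm using Nat.decreasingInduction with
  | self => exact hN
  | of_succ k _ ih => rw [hF, hG, ih]

def oP (q : A) (N m : ℕ) : A := ∏ k ∈ Ico m N, (1 + q ^ (2 * k + 1))
def eP (q : A) (N m : ℕ) : A := ∏ k ∈ Ico m N, (1 + q ^ (2 * k + 2))

theorem oP_succ {q : A} {N : ℕ} (hq : q ^ N = 0) (m : ℕ) :
    oP q N m = (1 + q ^ (2 * m + 1)) * oP q N (m + 1) := by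
  unfold oP
  rcases lt_or_ge m N with h | h
  · rw [Finset.prod_eq_prod_Ico_succ_bot h]
  · rw [Finset.Ico_eq_empty (by omega), Finset.Ico_eq_empty (by omega),
      pow_eq_zero_of_le (by omega) hq]
    simp

theorem eP_succ {q : A} {N : ℕ} (hq : q ^ N = 0) (m : ℕ) :
    eP q N m = (1 + q ^ (2 * m + 2)) * eP q N (m + 1) := by
  unfold eP
  rcases lt_or_ge m N with h | h
  · rw [Finset.prod_eq_prod_Ico_succ_bot h]
  · rw [Finset.Ico_eq_empty (by omega), Finset.Ico_eq_empty (by omega),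
      pow_eq_zero_of_le (by omega) hq]
    simp

theorem oP_top {q : A} {N : ℕ} {m : ℕ} (hm : N ≤ m) : oP q N m = 1 := by
  unfold oP
  rw [Finset.Ico_eq_empty (by omega)]; simp

theorem eP_top {q : A} {N : ℕ} {m : ℕ} (hm : N ≤ m) : eP q N m = 1 := by
  unfold eP
  rw [Finset.Ico_eq_empty (by omega)]; simp

theorem tP_even {q : A} {N : ℕ} (hq : q ^ N = 0) (m : ℕ) (hm : m ≤ N) :
    tP q N (-1) (2 * m) = oP q N m * eP q N m := by
  refine down_unique (F := fun m => tP q N (-1) (2 * m)) (G := fun m => oP q N m * eP q N m)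
    (c := fun m => (1 + q ^ (2 * m + 1)) * (1 + q ^ (2 * m + 2))) N ?_ ?_ ?_ m hm
  · intro m
    rw [tP_succ hq, tP_succ hq, show 2 * (m + 1) = 2 * m + 1 + 1 by ring]
    ring
  · intro m
    rw [oP_succ hq, eP_succ hq]; ring
  · rw [oP_top le_rfl, eP_top le_rfl, tP_top _ (by omega)]; simp

theorem tP_odd {q : A} {N : ℕ} (hq : q ^ N = 0) (m : ℕ) (hm : m < N) :
    tP q N (-1) (2 * m + 1) = oP q N (m + 1) * eP q N m := by
  rw [tP_succ hq, show 2 * m + 1 + 1 = 2 * (m + 1) by ring, tP_even hq _ (by omega), eP_succ hq m]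
  ring

/-- the sum `∑ q^(2m+1) (-q^(2m+2);q)_∞`. -/
def dO (q : A) (N : ℕ) : A := ∑ m ∈ range N, q ^ (2 * m + 1) * (oP q N (m + 1) * eP q N m)

/-- rank series, summed over the largest part -/
def rS (q : A) (N : ℕ) (z zi : A) : A := 1 + ∑ l ∈ range N, z ^ l * q ^ (l + 1) * iP q N zi (l + 1)

theorem sum_range_two_mul (h : ℕ → A) (n : ℕ) :
    ∑ l ∈ range (2 * n), h l = ∑ m ∈ range n, (h (2 * m) + h (2 * m + 1)) := by
  induction n with
  | zero => simp
  | succ n ih =>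
    rw [show 2 * (n + 1) = 2 * n + 1 + 1 by ring, Finset.sum_range_succ, Finset.sum_range_succ, ih,
      Finset.sum_range_succ]
    ring

theorem rS_neg_one {q : A} {N : ℕ} (hq : q ^ N = 0) :
    rS q N (-1) (-1) * tP q N (-1) 0 = 1 + 2 * dO q N := by
  have ext : ∀ h : ℕ → A, ∑ l ∈ range N, q ^ (l + 1) * h l =
      ∑ m ∈ range N, (q ^ (2 * m + 1) * h (2 * m) + q ^ (2 * m + 1 + 1) * h (2 * m + 1)) := by
    intro h
    rw [← sum_range_two_mul (fun l => q ^ (l + 1) * h l)]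
    apply Finset.sum_subset
    · intro x; simp; omega
    · intro x _ hx
      rw [pow_eq_zero_of_le _ hq, zero_mul]
      simp at hx; omega
  have h1 : tP q N (-1) 0 = 1 + ∑ l ∈ range N, q ^ (l + 1) * tP q N (-1) (l + 1) := by
    have : ∀ l ∈ range N, q ^ (l + 1) * tP q N (-1) (l + 1) = tP q N (-1) l - tP q N (-1) (l + 1) := by
      intro l _
      rw [tP_succ hq (-1) l]; ring
    rw [Finset.sum_congr rfl this, Finset.sum_range_sub', tP_top _ le_rfl]; ring
  have h2 : rS q N (-1) (-1) * tP q N (-1) 0 = tP q N (-1) 0 +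
      ∑ l ∈ range N, q ^ (l + 1) * ((-1) ^ l * tP q N (-1) (l + 1)) := by
    unfold rS
    rw [add_mul, one_mul, Finset.sum_mul]
    congr 1
    apply Finset.sum_congr rfl
    intro l _
    rw [← iP_mul_tP hq (-1) (l + 1)]; ring
  rw [h2, h1, add_assoc, ← Finset.sum_add_distrib]
  simp_rw [← mul_add]
  rw [ext, dO, Finset.mul_sum]
  congr 1
  apply Finset.sum_congr rfl
  intro m hm
  have s1 : (-1 : A) ^ (2 * m) = 1 := by rw [pow_mul]; simp
  have s2 : (-1 : A) ^ (2 * m + 1) = -1 := by rw [pow_succ, s1]; simp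
  rw [tP_odd hq m (Finset.mem_range.1 hm), s1, s2]
  ring

/-- `φ(x)` -/
def phiS (x : A) (N : ℕ) : A := ∑ n ∈ range N, x ^ (n ^ 2) * ∏ j ∈ range n, gInv x N (-1) (2 * j + 2)

theorem gInv_neg (q : A) (N j : ℕ) (c : A) : gInv (-q) N c (2 * j + 2) = gInv q N c (2 * j + 2) := by
  unfold gInv
  rw [Even.neg_pow ⟨j + 1, by ring⟩]

theorem phi_neg {q : A} {N : ℕ} (hq : q ^ N = 0) :
    phiS (-q) N * tP q N (-1) 0 = dO q N + ∑ n ∈ range N, (-1) ^ n * q ^ (n ^ 2) := by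
  have hE : ∀ n, (∏ j ∈ range n, gInv q N (-1) (2 * j + 2)) * eP q N 0 = eP q N n := by
    intro n
    induction n with
    | zero => simp
    | succ n ih =>
      have h1 := eP_succ hq n
      have h2 := gInv_mul hq (-1) (k := 2 * n + 2) (by omega)
      rw [Finset.prod_range_succ]
      linear_combination (gInv q N (-1) (2 * n + 2)) * ih + (gInv q N (-1) (2 * n + 2)) * h1 +
        eP q N (n + 1) * h2
  have h0 : phiS (-q) N * tP q N (-1) 0 =
      ∑ n ∈ range N, (-1) ^ n * q ^ (n ^ 2) * (oP q N 0 * eP q N (n + 0)) := by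
    have := tP_even hq 0 (by omega)
    simp only [mul_zero] at this
    rw [this]
    unfold phiS
    rw [Finset.sum_mul]
    apply Finset.sum_congr rfl
    intro n _
    simp_rw [gInv_neg]
    have hp : (-q) ^ (n ^ 2) = (-1) ^ n * q ^ (n ^ 2) := by
      rw [neg_pow]
      congr 1
      rcases Nat.even_or_odd n with h | h
      · rw [h.neg_one_pow, (h.pow_of_ne_zero two_ne_zero).neg_one_pow]
      · rw [h.neg_one_pow, h.pow.neg_one_pow]
    rw [hp, add_zero, ← hE n]; ring
  have step : ∀ m, ∑ n ∈ range N, (-1) ^ n * q ^ (n ^ 2) * (oP q N m * eP q N (n + m)) =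
      q ^ (2 * m + 1) * (oP q N (m + 1) * eP q N m) +
      ∑ n ∈ range N, (-1) ^ n * q ^ (n ^ 2) * (oP q N (m + 1) * eP q N (n + (m + 1))) := by
    intro m
    rw [← sub_eq_iff_eq_add, ← Finset.sum_sub_distrib]
    have : ∀ n ∈ range N, (-1) ^ n * q ^ (n ^ 2) * (oP q N m * eP q N (n + m)) -
        (-1) ^ n * q ^ (n ^ 2) * (oP q N (m + 1) * eP q N (n + (m + 1))) =
        (-1) ^ n * q ^ (n ^ 2 + (2 * m + 1)) * (oP q N (m + 1) * eP q N (n + m)) -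
        (-1) ^ (n + 1) * q ^ ((n + 1) ^ 2 + (2 * m + 1)) * (oP q N (m + 1) * eP q N (n + 1 + m)) := by
      intro n _
      rw [oP_succ hq m, eP_succ hq (n + m), show n + (m + 1) = n + m + 1 by ring,
        show n + 1 + m = n + m + 1 by ring]
      ring
    rw [Finset.sum_congr rfl this, Finset.sum_range_sub'
      (fun n => (-1) ^ n * q ^ (n ^ 2 + (2 * m + 1)) * (oP q N (m + 1) * eP q N (n + m)))]
    rw [pow_eq_zero_of_le (show N ≤ N ^ 2 + (2 * m + 1) by nlinarith) hq]
    simp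
  have all : ∀ J, phiS (-q) N * tP q N (-1) 0 =
      ∑ m ∈ range J, q ^ (2 * m + 1) * (oP q N (m + 1) * eP q N m) +
      ∑ n ∈ range N, (-1) ^ n * q ^ (n ^ 2) * (oP q N J * eP q N (n + J)) := by
    intro J
    induction J with
    | zero => simpa using h0
    | succ J ih => rw [ih, step J, Finset.sum_range_succ]; ring
  rw [all N, dO]
  congr 1
  apply Finset.sum_congr rfl
  intro n _
  rw [oP_top le_rfl, eP_top (by omega)]; ring

theorem rS_eq_phi {q : A} {N : ℕ} (hq : q ^ N = 0) (hN : 1 ≤ N) {z zi : A} (hz : z * zi = 1)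
    (hz2 : z + zi = 0) : rS q N z zi = phiS q N := by
  set e : ℕ → ℕ → A := fun m n => z ^ n * q ^ (m * n) * ∏ i ∈ range n, gInv q N zi (m + 1 + i) with he
  set X : ℕ → A := fun m => ∑ n ∈ range N, e m n with hX
  have hstep : ∀ m, 1 ≤ m → (1 - z * q ^ m) * X m = 1 + q ^ (2 * m + 1) * gInv q N zi (m + 1) * X (m + 1) := by
    intro m hm
    have heN : e m N = 0 := by
      simp only [he]
      rw [pow_eq_zero_of_le (show N ≤ m * N by nlinarith) hq]; simp
    have h1 : X m = 1 + ∑ n ∈ range N, e m (n + 1) := by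
      have := Finset.sum_range_succ (e m) N
      rw [Finset.sum_range_succ', heN] at this
      have h0 : e m 0 = 1 := by simp [he]
      rw [h0] at this
      simp only [hX]
      linear_combination -this
    have h2 : ∀ n ∈ range N, e m (n + 1) - z * q ^ m * e m n = q ^ (2 * m + 1) * gInv q N zi (m + 1) * e (m + 1) n := by
      intro n _
      have hg := gInv_mul hq zi (k := m + 1 + n) (by omega)
      have hr : e m (n + 1) = z * q ^ m * e m n * gInv q N zi (m + 1 + n) := by
        simp only [he]; rw [Finset.prod_range_succ]; ring
      have hr2 : q ^ (2 * m + 1) * gInv q N zi (m + 1) * e (m + 1) n = zi * q ^ (m + 1 + n) * e m (n + 1) := by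
        simp only [he]
        rw [Finset.prod_range_succ' _ n]
        have : ∏ i ∈ range n, gInv q N zi (m + 1 + 1 + i) = ∏ k ∈ range n, gInv q N zi (m + 1 + (k + 1)) := by
          apply Finset.prod_congr rfl; intro i _; congr 1; ring
        rw [this]
        simp only [add_zero]
        linear_combination (-(q ^ (m + 1 + n) * z ^ n * q ^ (m * (n + 1)) * ((∏ k ∈ range n, gInv q N zi (m + 1 + (k + 1))) * gInv q N zi (m + 1)))) * hz
      rw [hr2]
      linear_combination (1 - zi * q ^ (m + 1 + n)) * hr + z * q ^ m * e m n * hg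
    have h3 := Finset.sum_congr (rfl : range N = range N) h2
    rw [Finset.sum_sub_distrib, ← Finset.mul_sum, ← Finset.mul_sum] at h3
    change _ - z * q ^ m * X m = _ * X (m + 1) at h3
    linear_combination h1 + h3
  have hR0 : rS q N z zi = 1 + q * gInv q N zi 1 * X 1 := by
    simp only [rS, hX, he]
    rw [Finset.mul_sum]
    congr 1
    apply Finset.sum_congr rfl
    intro l _
    rw [iP, Finset.prod_range_succ']
    have : ∏ i ∈ range l, gInv q N zi (1 + 1 + i) = ∏ k ∈ range l, gInv q N zi (k + 1 + 1) := by
      apply Finset.prod_congr rfl; intro i _; congr 1; ring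
    rw [this]; ring
  have hRJ : ∀ J, rS q N z zi = ∑ n ∈ range (J + 1), q ^ (n ^ 2) * (iP q N zi n * iP q N z n) +
      q ^ ((J + 1) ^ 2) * iP q N zi (J + 1) * iP q N z J * X (J + 1) := by
    intro J
    induction J with
    | zero => rw [hR0]; simp [iP]
    | succ J ih =>
      rw [ih, Finset.sum_range_succ _ (J + 1)]
      have h3 : ∀ c n, iP q N c (n + 1) = iP q N c n * gInv q N c (n + 1) := by
        intro c n; simp [iP, Finset.prod_range_succ]
      have hs := hstep (J + 1) (by omega)
      have hg := gInv_mul hq z (k := J + 1) (by omega)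
      rw [h3 zi (J + 1), h3 z J]
      have e1 : q ^ ((J + 1 + 1) ^ 2) = q ^ ((J + 1) ^ 2) * q ^ (2 * (J + 1) + 1) := by ring
      rw [e1]
      linear_combination (q ^ ((J + 1) ^ 2) * iP q N zi (J + 1) * iP q N z J * gInv q N z (J + 1)) * hs
        - (q ^ ((J + 1) ^ 2) * iP q N zi (J + 1) * iP q N z J * X (J + 1)) * hg
  have hfin := hRJ (N - 1)
  rw [Nat.sub_add_cancel hN, pow_eq_zero_of_le (show N ≤ N ^ 2 by nlinarith) hq] at hfin
  rw [hfin, phiS]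
  simp only [zero_mul, add_zero]
  apply Finset.sum_congr rfl
  intro n _
  congr 1
  rw [iP, iP, ← Finset.prod_mul_distrib]
  apply Finset.prod_congr rfl
  intro j _
  apply cancel_one_sub hq (-1) (k := 2 * j + 2) (by omega)
  rw [gInv_mul hq (-1) (by omega)]
  have h1 := gInv_mul hq z (k := j + 1) (by omega)
  have h2 := gInv_mul hq zi (k := j + 1) (by omega)
  have e1 : q ^ (2 * j + 2) = q ^ (j + 1) * q ^ (j + 1) := by ring
  rw [e1]
  linear_combination h1 + (1 - z * q ^ (j + 1)) * gInv q N z (j+1) * h2 + (q ^ (j + 1) * gInv q N zi (j + 1) * gInv q N z (j + 1)) * hz2 - (q ^ (j + 1) * q ^ (j + 1) * gInv q N zi (j + 1) * gInv q N z (j + 1)) * hz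

/-- crank series -/
def cS (q : A) (N : ℕ) (z zi : A) : A :=
  1 + ∑ L ∈ range N, z ^ (L + 2) * q ^ (L + 2) * ∏ i ∈ range (L + 1), gInv q N 1 (i + 2) +
  ∑ k ∈ range N, zi ^ (k + 1) * q ^ (k + 1) * (∏ i ∈ range k, gInv q N 1 (i + 2)) *
    ∏ i ∈ Ico (k + 1) N, gInv q N z (i + 1)

theorem cS_tP {q : A} {N : ℕ} (hq : q ^ N = 0) (hN : 1 ≤ N) (z zi : A) :
    (cS q N z zi + (z - 1) * q) * tP q N z 0 = (1 - q) * gB q N (z * q) zi 1 := by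
  have hq2 : ∀ k, (1 - q) * iP q N 1 (k + 1) = ∏ i ∈ range k, gInv q N 1 (i + 2) := by
    intro k
    rw [iP, Finset.prod_range_succ']
    have := gInv_mul hq 1 (k := 1) (by omega)
    simp only [zero_add]
    linear_combination (∏ k ∈ range k, gInv q N 1 (k + 1 + 1)) * this
  have hE := gB_prod hq hN 0 z
  have hE2 : tP q N (0 * z) 0 = 1 := by simp [tP]
  rw [hE2] at hE
  have hext : ∀ a c : A, gB q N a c 1 = 1 + ∑ k ∈ range N,
      (∏ i ∈ range (k + 1), (1 - a * q ^ i)) * c ^ (k + 1) * q ^ (k + 1) * iP q N 1 (k + 1) := by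
    intro a c
    have := Finset.sum_range_succ (fun k => (∏ i ∈ range k, (1 - a * q ^ i)) * c ^ k * q ^ k * iP q N 1 k) N
    rw [Finset.sum_range_succ', hq] at this
    simp only [gB, one_mul]
    simp only [iP, range_zero, prod_empty, pow_zero, mul_one, mul_zero, zero_mul, add_zero] at this ⊢
    rw [← this]; ring
  have h1 : (1 - q) * gB q N 0 z 1 = 1 + ∑ L ∈ range N, z ^ (L + 2) * q ^ (L + 2) *
      ∏ i ∈ range (L + 1), gInv q N 1 (i + 2) + (z - 1) * q := by
    rw [hext]
    have h2 := Finset.sum_range_succ (fun k => z ^ (k + 1) * q ^ (k + 1) * ∏ i ∈ range k, gInv q N 1 (i + 2)) N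
    rw [Finset.sum_range_succ', pow_eq_zero_of_le (show N ≤ N + 1 by omega) hq] at h2
    rw [mul_add, Finset.mul_sum]
    have h3 : ∀ k ∈ range N, (1 - q) * ((∏ i ∈ range (k + 1), (1 - 0 * q ^ i)) * z ^ (k + 1) * q ^ (k + 1) * iP q N 1 (k + 1))
       = z ^ (k + 1) * q ^ (k + 1) * ∏ i ∈ range k, gInv q N 1 (i + 2) := by
      intro k _
      rw [← hq2 k]; simp; ring
    rw [Finset.sum_congr rfl h3]
    simp only [range_zero, prod_empty, mul_one, mul_zero, zero_mul, add_zero, zero_add, pow_one, add_assoc, Nat.reduceAdd] at h2 ⊢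
    linear_combination -h2
  have h4 : ∀ k < N, (∏ i ∈ Ico (k + 1) N, gInv q N z (i + 1)) * tP q N z 0 =
      ∏ i ∈ range (k + 1), (1 - z * q * q ^ i) := by
    intro k hk
    have ha : (∏ i ∈ Ico (k + 1) N, gInv q N z (i + 1)) * tP q N z (k + 1) = 1 := by
      rw [tP, ← Finset.prod_mul_distrib]
      apply Finset.prod_eq_one
      intro i _
      rw [mul_comm]; exact gInv_mul hq z (by omega)
    have hb : tP q N z 0 = (∏ i ∈ range (k + 1), (1 - z * q * q ^ i)) * tP q N z (k + 1) := by
      unfold tP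
      rw [← Finset.range_eq_Ico, ← Finset.prod_range_mul_prod_Ico _ (show k + 1 ≤ N by omega)]
      congr 1
      apply Finset.prod_congr rfl; intro i _; ring
    rw [hb]
    linear_combination (∏ i ∈ range (k + 1), (1 - z * q * q ^ i)) * ha
  have h5 : cS q N z zi + (z - 1) * q = (1 - q) * gB q N 0 z 1 +
    ∑ k ∈ range N, zi ^ (k + 1) * q ^ (k + 1) * (∏ i ∈ range k, gInv q N 1 (i + 2)) *
    ∏ i ∈ Ico (k + 1) N, gInv q N z (i + 1) := by
    rw [h1, cS]; ring
  rw [h5, add_mul, mul_assoc, hE, hext, mul_add, Finset.sum_mul, Finset.mul_sum]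
  congr 1
  apply Finset.sum_congr rfl
  intro k hk
  rw [mul_assoc, h4 k (Finset.mem_range.1 hk), ← hq2 k]
  ring

theorem cS_symm {q : A} {N : ℕ} (hq : q ^ N = 0) (hN : 1 ≤ N) {z zi : A} (hz : z * zi = 1) :
    cS q N z zi + (z - 1) * q = cS q N zi z + (zi - 1) * q := by
  have h1 := cS_tP hq hN z zi
  have h2 := cS_tP hq hN zi z
  have h3 := gB_prod hq hN (z * q) zi
  have h4 := gB_prod hq hN (zi * q) z
  have e1 : z * q * zi = q := by linear_combination q * hz
  have e2 : zi * q * z = q := by linear_combination q * hz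
  rw [e1] at h3
  rw [e2] at h4
  apply cancel_tP hq z
  apply cancel_tP hq zi
  rw [h1]
  linear_combination (1 - q) * h3 - (1 - q) * h4 - tP q N z 0 * h2

theorem main_alg {q : A} {N : ℕ} (hq : q ^ N = 0) (hN : 1 ≤ N) :
    2 * phiS (-q) N = rS q N (-1) (-1) + (cS q N (-1) (-1) + (-1 - 1) * q) := by
  apply cancel_tP hq (-1)
  have h1 := cS_tP hq hN (-1) (-1)
  have h2 := gauss hq
  have h3 := phi_neg hq
  have h4 := rS_neg_one hq
  have h5 : gB q N (-1 * q) (-1) 1 = xG q N 0 := by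
    unfold gB xG
    apply Finset.sum_congr rfl
    intro k _
    rw [iP]
    have ea : ∏ i ∈ range k, (1 - -1 * q * q ^ i) = ∏ i ∈ range k, (1 + q ^ (0 + 1 + i)) := by
      apply Finset.prod_congr rfl; intro i _; ring
    have eb : ∏ i ∈ range k, gInv q N 1 (i + 1) = ∏ i ∈ range k, gInv q N 1 (0 + 1 + i) := by
      apply Finset.prod_congr rfl; intro i _; congr 1; ring
    rw [ea, eb]
  rw [h5] at h1
  have h6 := Finset.sum_range_succ (fun n => (-1 : A) ^ n * q ^ (n ^ 2)) N
  rw [Finset.sum_range_succ', pow_eq_zero_of_le (show N ≤ N ^ 2 by nlinarith) hq] at h6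
  simp only [pow_zero, mul_one, mul_zero, add_zero, ne_eq, OfNat.ofNat_ne_zero, not_false_eq_true, zero_pow] at h6
  linear_combination 2 * h3 - h4 - h1 - h2 - 2 * h6
end qalg2

section comb
variable {A : Type*} [CommRing A]

theorem card_filter_parts {n N : ℕ} (π : n.Partition) (hn : n < N) (p : ℕ → Prop) [DecidablePred p] :
    ∑ i ∈ range N, (if p (i + 1) then π.parts.count (i + 1) else 0) = (π.parts.filter p).card := by
  rw [← Multiset.toFinset_sum_count_eq]
  have h2 : ∑ i ∈ range (N + 1), (if p i then π.parts.count i else 0) =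
      ∑ a ∈ (π.parts.filter p).toFinset, (π.parts.filter p).count a := by
    symm
    simp_rw [Multiset.count_filter]
    apply Finset.sum_subset
    · intro x hx
      have := π.le_of_mem_parts (Multiset.mem_of_mem_filter (Multiset.mem_toFinset.1 hx))
      simp; omega
    · intro x _ hx
      rw [Multiset.mem_toFinset, Multiset.mem_filter] at hx
      split_ifs with h
      · rw [Multiset.count_eq_zero]; tauto
      · rfl
  rw [← h2, Finset.sum_range_succ']
  have : π.parts.count 0 = 0 := by
    rw [Multiset.count_eq_zero]; intro h; exact absurd (π.parts_pos h) (lt_irrefl _)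
  simp [this]

theorem sup_le_iff_count {n N : ℕ} (π : n.Partition) (hn : n < N) (L : ℕ) :
    π.parts.sup ≤ L ↔ ∀ i ∈ range N, L ≤ i → π.parts.count (i + 1) = 0 := by
  rw [Multiset.sup_le]
  constructor
  · intro h i _ hi
    rw [Multiset.count_eq_zero]
    intro hm
    have := h _ hm
    omega
  · intro h b hb
    by_contra hlt
    have h1 := π.le_of_mem_parts hb
    have h2 := h (b - 1) (by simp; omega) (by omega)
    rw [Nat.sub_add_cancel (by omega), Multiset.count_eq_zero] at h2
    exact h2 hb

theorem sup_le_size {n : ℕ} (π : n.Partition) : π.parts.sup ≤ n :=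
  Multiset.sup_le.2 fun _ hb => π.le_of_mem_parts hb

/-- partition generating function of a weight. -/
def pF (q : A) (N : ℕ) (w : Multiset ℕ → A) : A :=
  ∑ n ∈ range N, (∑ π : n.Partition, w π.parts) * q ^ n

theorem pF_congr {q : A} {N : ℕ} {w w' : Multiset ℕ → A}
    (h : ∀ n (π : n.Partition), n < N → w π.parts = w' π.parts) : pF q N w = pF q N w' := by
  unfold pF
  apply Finset.sum_congr rfl
  intro n hn
  congr 1
  exact Finset.sum_congr rfl fun π _ => h n π (Finset.mem_range.1 hn)

theorem pF_add (q : A) (N : ℕ) (w w' : Multiset ℕ → A) :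
    pF q N (fun s => w s + w' s) = pF q N w + pF q N w' := by
  simp [pF, Finset.sum_add_distrib, add_mul]

theorem pF_sub (q : A) (N : ℕ) (w w' : Multiset ℕ → A) :
    pF q N (fun s => w s - w' s) = pF q N w - pF q N w' := by
  simp [pF, Finset.sum_sub_distrib, sub_mul]

theorem pF_mul (q : A) (N : ℕ) (c : A) (w : Multiset ℕ → A) :
    pF q N (fun s => c * w s) = c * pF q N w := by
  simp [pF, ← Finset.mul_sum, mul_assoc]

theorem pF_sum (q : A) (N : ℕ) (t : Finset ℕ) (w : ℕ → Multiset ℕ → A) :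
    pF q N (fun s => ∑ k ∈ t, w k s) = ∑ k ∈ t, pF q N (w k) := by
  induction t using Finset.induction_on with
  | empty => simp [pF]
  | insert a t ha ih => simp only [Finset.sum_insert ha, pF_add, ih]

theorem pow_eq_tele (z : A) (s N : ℕ) (hs : s ≤ N) :
    z ^ s = (if s ≤ 0 then 1 else 0) +
      ∑ L ∈ range N, z ^ (L + 1) * ((if s ≤ L + 1 then 1 else 0) - (if s ≤ L then 1 else 0)) := by
  rcases s with _ | s
  · simp
  · rw [Finset.sum_eq_single s]
    · simp
    · intro b _ hb
      have : (s + 1 ≤ b + 1) ↔ (s + 1 ≤ b) := by omega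
      simp [this]
    · intro h; simp at h; omega

theorem pF_sup (q : A) (N : ℕ) (z : A) (v : Multiset ℕ → A) :
    pF q N (fun s => z ^ s.sup * v s) = pF q N (fun s => if s.sup ≤ 0 then v s else 0) +
      ∑ L ∈ range N, z ^ (L + 1) * (pF q N (fun s => if s.sup ≤ L + 1 then v s else 0) -
        pF q N (fun s => if s.sup ≤ L then v s else 0)) := by
  simp_rw [← pF_sub, ← pF_mul]
  rw [← pF_sum, ← pF_add]
  apply pF_congr
  intro n π hn
  have := sup_le_size π
  rw [pow_eq_tele z _ N (by omega : π.parts.sup ≤ N), add_mul, Finset.sum_mul]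
  congr 1
  · split_ifs <;> simp
  · apply Finset.sum_congr rfl
    intro L _
    rw [mul_assoc, sub_mul]
    congr 2 <;> split_ifs <;> simp

theorem fac_geom (q : A) (N i : ℕ) (c : A) :
    ∑ j ∈ range N, c ^ j * q ^ ((i + 1) * j) = gInv q N c (i + 1) := by
  unfold gInv
  apply Finset.sum_congr rfl
  intro j _
  rw [mul_pow, ← pow_mul]

theorem fac_single (q : A) (N i k : ℕ) (hk : k < N) :
    ∑ j ∈ range N, (if j = k then (1 : A) else 0) * q ^ ((i + 1) * j) = q ^ ((i + 1) * k) := by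
  rw [Finset.sum_eq_single k]
  · simp
  · intro b _ hb; simp [hb]
  · intro h; simp at h; omega

theorem pF_rank_le {q : A} {N : ℕ} (hq : q ^ N = 0) (hN : 1 ≤ N) (c : A) (L : ℕ) (hL : L ≤ N) :
    pF q N (fun s => if s.sup ≤ L then c ^ s.card else 0) = iP q N c L := by
  have h := pf_prod q N hq (fun i j => if L ≤ i then (if j = 0 then 1 else 0) else c ^ j)
  have hl : pF q N (fun s => if s.sup ≤ L then c ^ s.card else 0) =
    pF q N (fun s => ∏ i ∈ range N, if L ≤ i then (if s.count (i + 1) = 0 then 1 else 0) else c ^ s.count (i + 1)) := by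
    apply pF_congr
    intro n π hn
    split_ifs with hs
    · rw [sup_le_iff_count π hn] at hs
      have hc := card_filter_parts π hn (fun _ => True)
      simp only [if_true, Multiset.filter_true] at hc
      rw [← hc, ← Finset.prod_pow_eq_pow_sum]
      apply Finset.prod_congr rfl
      intro i hi
      split_ifs with h1 h2
      · simp [h2]
      · exact absurd (hs i hi h1) h2
      · rfl
    · rw [sup_le_iff_count π hn] at hs
      push Not at hs
      obtain ⟨i, hi, h1, h2⟩ := hs
      symm
      apply Finset.prod_eq_zero hi
      simp [h1, h2]
  rw [hl]
  refine h.trans ?_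
  have : ∀ i ∈ range N, ∑ j ∈ range N, (if L ≤ i then (if j = 0 then (1 : A) else 0) else c ^ j) * q ^ ((i + 1) * j)
      = if L ≤ i then 1 else gInv q N c (i + 1) := by
    intro i _
    split_ifs with h1
    · rw [fac_single q N i 0 (by omega)]; simp
    · exact fac_geom q N i c
  rw [Finset.prod_congr rfl this, iP, ← Finset.prod_range_mul_prod_Ico _ hL]
  rw [Finset.prod_eq_one (s := Ico L N), mul_one]
  · apply Finset.prod_congr rfl
    intro i hi
    simp at hi
    rw [if_neg (by omega)]
  · intro i hi
    simp at hi
    rw [if_pos (by omega)]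

theorem pF_rank {q : A} {N : ℕ} (hq : q ^ N = 0) (hN : 1 ≤ N) {z zi : A} (hz : z * zi = 1) :
    pF q N (fun s => z ^ s.sup * zi ^ s.card) = rS q N z zi := by
  rw [pF_sup, pF_rank_le hq hN zi 0 (by omega), rS]
  congr 1
  apply Finset.sum_congr rfl
  intro L hL
  simp at hL
  rw [pF_rank_le hq hN zi (L + 1) (by omega), pF_rank_le hq hN zi L (by omega)]
  have h3 : iP q N zi (L + 1) = iP q N zi L * gInv q N zi (L + 1) := by
    simp [iP, Finset.prod_range_succ]
  have hg := gInv_mul hq zi (k := L + 1) (by omega)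
  rw [h3]
  linear_combination (z ^ L * q ^ (L + 1) * iP q N zi L * gInv q N zi (L + 1)) * hz + z ^ (L + 1) * iP q N zi L * hg

theorem pF_crank_le {q : A} {N : ℕ} (hq : q ^ N = 0) (hN : 1 ≤ N) (L : ℕ) (hL : L + 1 ≤ N) :
    pF q N (fun s => if s.sup ≤ L + 1 then (if s.count 1 = 0 then 1 else 0) else 0) =
      ∏ i ∈ range L, gInv q N 1 (i + 2) := by
  have h := pf_prod q N hq (fun i j => if i = 0 ∨ L + 1 ≤ i then (if j = 0 then 1 else 0) else 1 ^ j)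
  refine Eq.trans ?_ (h.trans ?_)
  · apply pF_congr (w' := fun s => ∏ i ∈ range N,
      if i = 0 ∨ L + 1 ≤ i then (if s.count (i + 1) = 0 then 1 else 0) else 1 ^ s.count (i + 1))
    intro n π hn
    by_cases hs : π.parts.sup ≤ L + 1
    · rw [if_pos hs]
      rw [sup_le_iff_count π hn] at hs
      by_cases h0 : π.parts.count 1 = 0
      · rw [if_pos h0]
        symm
        apply Finset.prod_eq_one
        intro i hi
        split_ifs with h1 h2
        · rfl
        · rcases h1 with rfl | h1
          · exact absurd h0 h2
          · exact absurd (hs i hi h1) h2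
        · simp
      · rw [if_neg h0]
        symm
        apply Finset.prod_eq_zero (i := 0) (by simp; omega)
        simp [h0]
    · rw [if_neg hs]
      rw [sup_le_iff_count π hn] at hs
      push Not at hs
      obtain ⟨i, hi, h1, h2⟩ := hs
      symm
      apply Finset.prod_eq_zero hi
      simp [h1, h2]
  · have : ∀ i ∈ range N, ∑ j ∈ range N, (if i = 0 ∨ L + 1 ≤ i then (if j = 0 then (1 : A) else 0) else 1 ^ j) * q ^ ((i + 1) * j)
      = if i = 0 ∨ L + 1 ≤ i then 1 else gInv q N 1 (i + 1) := by
      intro i _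
      split_ifs with h1
      · rw [fac_single q N i 0 (by omega)]; simp
      · exact fac_geom q N i 1
    rw [Finset.prod_congr rfl this, ← Finset.prod_range_mul_prod_Ico _ hL]
    rw [Finset.prod_eq_one (s := Ico (L + 1) N), mul_one, Finset.prod_range_succ']
    · simp only [true_or, if_true, mul_one]
      apply Finset.prod_congr rfl
      intro i hi
      simp at hi
      rw [if_neg (by omega)]
    · intro i hi
      simp at hi
      rw [if_pos (by omega)]

theorem pF_crank_ones {q : A} {N : ℕ} (hq : q ^ N = 0) (z : A) (k : ℕ) (hk : k + 1 < N) :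
    pF q N (fun s => if s.count 1 = k + 1 then z ^ (s.filter (fun x => k + 1 < x)).card else 0) =
      q ^ (k + 1) * (∏ i ∈ range k, gInv q N 1 (i + 2)) * ∏ i ∈ Ico (k + 1) N, gInv q N z (i + 1) := by
  have h := pf_prod q N hq (fun i j => if i = 0 then (if j = k + 1 then 1 else 0) else
    if k + 1 ≤ i then z ^ j else 1 ^ j)
  refine Eq.trans ?_ (h.trans ?_)
  · apply pF_congr (w' := fun s => ∏ i ∈ range N, if i = 0 then (if s.count (i + 1) = k + 1 then 1 else 0) else
      if k + 1 ≤ i then z ^ s.count (i + 1) else 1 ^ s.count (i + 1))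
    intro n π hn
    split_ifs with h0
    · rw [← card_filter_parts π hn, ← Finset.prod_pow_eq_pow_sum]
      apply Finset.prod_congr rfl
      intro i _
      rcases i with _ | i
      · simp [h0]
      · by_cases hi : k + 1 ≤ i + 1
        · rw [if_pos (by omega), if_neg (by omega), if_pos hi]
        · rw [if_neg (by omega), if_neg (by omega), if_neg hi]; simp
    · symm
      apply Finset.prod_eq_zero (i := 0) (by simp; omega)
      simp [h0]
  · have : ∀ i ∈ range N, ∑ j ∈ range N, (if i = 0 then (if j = k + 1 then (1 : A) else 0) else
        if k + 1 ≤ i then z ^ j else 1 ^ j) * q ^ ((i + 1) * j)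
      = if i = 0 then q ^ (k + 1) else if k + 1 ≤ i then gInv q N z (i + 1) else gInv q N 1 (i + 1) := by
      intro i _
      split_ifs with h1 h2
      · subst h1
        rw [fac_single q N 0 (k + 1) hk]; simp
      · exact fac_geom q N i z
      · exact fac_geom q N i 1
    rw [Finset.prod_congr rfl this, ← Finset.prod_range_mul_prod_Ico _ hk.le]
    congr 1
    · rw [Finset.prod_range_succ', mul_comm]
      simp only [if_true]
      congr 1
      apply Finset.prod_congr rfl
      intro i hi
      simp at hi
      rw [if_neg (by omega), if_neg (by omega)]
    · apply Finset.prod_congr rfl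
      intro i hi
      simp at hi
      rw [if_neg (by omega), if_pos (by omega)]

theorem pF_crank {q : A} {N : ℕ} (hq : q ^ N = 0) (hN : 1 ≤ N) (z zi : A) :
    pF q N (fun s => if s.count 1 = 0 then z ^ s.sup else
      z ^ (s.filter (fun x => s.count 1 < x)).card * zi ^ s.count 1) = cS q N z zi := by
  obtain ⟨M, rfl⟩ : ∃ M, N = M + 1 := ⟨N - 1, by omega⟩
  have hsplit : pF q (M + 1) (fun s => if s.count 1 = 0 then z ^ s.sup else
      z ^ (s.filter (fun x => s.count 1 < x)).card * zi ^ s.count 1) =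
      pF q (M + 1) (fun s => z ^ s.sup * (if s.count 1 = 0 then 1 else 0)) +
      ∑ k ∈ range M, zi ^ (k + 1) * pF q (M + 1)
        (fun s => if s.count 1 = k + 1 then z ^ (s.filter (fun x => k + 1 < x)).card else 0) := by
    simp_rw [← pF_mul]
    rw [← pF_sum, ← pF_add]
    apply pF_congr
    intro n π hn
    have hc : π.parts.count 1 ≤ n := by
      have h1 := card_filter_parts π hn (fun x => x = 1)
      have h2 := Multiset.count_le_card 1 π.parts
      have h3 : π.parts.card ≤ π.parts.sum := by
        have := Multiset.card_nsmul_le_sum (s := π.parts) (a := 1) (fun x hx => π.parts_pos hx)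
        simpa using this
      rw [π.parts_sum] at h3
      omega
    by_cases h0 : π.parts.count 1 = 0
    · simp [h0]
    · obtain ⟨c, hc'⟩ : ∃ c, π.parts.count 1 = c + 1 := ⟨π.parts.count 1 - 1, by omega⟩
      rw [if_neg h0, if_neg h0, Finset.sum_eq_single c]
      · rw [hc']; simp; ring
      · intro b _ hb
        rw [if_neg (by omega)]; simp
      · intro h; simp at h; omega
  rw [hsplit, pF_sup, cS]
  congr 1
  · have hK0 : pF q (M + 1) (fun s => if s.sup ≤ 0 then (if s.count 1 = 0 then 1 else 0) else 0) = 1 := by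
      have h1 := pF_rank_le hq hN (1 : A) 0 (by omega)
      simp only [iP, range_zero, prod_empty] at h1
      refine Eq.trans ?_ h1
      apply pF_congr
      intro n π hn
      split_ifs with h1 h2
      · simp
      · exact absurd ((sup_le_iff_count π hn 0).1 h1 0 (by simp) le_rfl) h2
      · rfl
    rw [hK0]
    congr 1
    rw [Finset.sum_range_succ', Finset.sum_range_succ _ M]
    rw [pow_eq_zero_of_le (show M + 1 ≤ M + 2 by omega) hq, hK0, pF_crank_le hq hN 0 (by omega)]
    simp only [range_zero, prod_empty, sub_self, mul_zero, zero_mul, add_zero]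
    apply Finset.sum_congr rfl
    intro l hl
    simp at hl
    rw [pF_crank_le hq hN l (by omega), pF_crank_le hq hN (l + 1) (by omega), Finset.prod_range_succ]
    have hg := gInv_mul hq 1 (k := l + 2) (by omega)
    linear_combination (z ^ (l + 2) * ∏ i ∈ range l, gInv q (M + 1) 1 (i + 2)) * hg
  · rw [Finset.sum_range_succ _ M, hq]
    simp only [zero_mul, mul_zero, add_zero]
    apply Finset.sum_congr rfl
    intro k hk
    simp at hk
    rw [pF_crank_ones hq z k (by omega)]
    ring
end comb

section final
open PowerSeries

theorem map_gInv {A B : Type*} [CommRing A] [CommRing B] (f : A →+* B) (q : A) (N : ℕ) (c : A) (k : ℕ) :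
    f (gInv q N c k) = gInv (f q) N (f c) k := by simp [gInv]

theorem map_phiS {A B : Type*} [CommRing A] [CommRing B] (f : A →+* B) (q : A) (N : ℕ) :
    f (phiS q N) = phiS (f q) N := by simp [phiS, map_gInv]

theorem map_pF {A B : Type*} [CommRing A] [CommRing B] (f : A →+* B) (q : A) (N : ℕ) (w : Multiset ℕ → A) :
    f (pF q N w) = pF (f q) N (fun s => f (w s)) := by simp [pF]

theorem coeff_pF (N : ℕ) (w : Multiset ℕ → ℂ) (n : ℕ) (hn : n < N) :
    coeff n (pF (X : ℂ⟦X⟧) N (fun s => C (w s))) = ∑ π : n.Partition, w π.parts := by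
  rw [pF, map_sum, Finset.sum_eq_single n]
  · rw [← map_sum, coeff_C_mul, coeff_X_pow]; simp
  · intro b _ hb
    rw [← map_sum, coeff_C_mul, coeff_X_pow, if_neg (Ne.symm hb)]; simp
  · intro h
    exact absurd (Finset.mem_range.2 hn) h

theorem coeff_eq_of_mk {N : ℕ} {a b : ℂ⟦X⟧}
    (h : Ideal.Quotient.mk (Ideal.span {(X : ℂ⟦X⟧) ^ N}) a = Ideal.Quotient.mk (Ideal.span {(X : ℂ⟦X⟧) ^ N}) b)
    (n : ℕ) (hn : n < N) : coeff n a = coeff n b := by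
  rw [Ideal.Quotient.eq, Ideal.mem_span_singleton, X_pow_dvd_iff] at h
  have := h n hn
  rw [map_sub] at this
  exact sub_eq_zero.1 this

theorem coeff_phi_neg (N n : ℕ) :
    coeff n (phiS (-X : ℂ⟦X⟧) N) = (-1) ^ n * coeff n (phiS (X : ℂ⟦X⟧) N) := by
  have : (-X : ℂ⟦X⟧) = rescale (-1) X := by simp [rescale_X]
  rw [this, ← map_phiS, coeff_rescale]

def wR (z zi : ℂ) (s : Multiset ℕ) : ℂ := z ^ s.sup * zi ^ s.card
def wC (z zi : ℂ) (s : Multiset ℕ) : ℂ := if s.count 1 = 0 then z ^ s.sup else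
      z ^ (s.filter (fun x => s.count 1 < x)).card * zi ^ s.count 1

theorem mkX_pow (N : ℕ) : (Ideal.Quotient.mk (Ideal.span {(X : ℂ⟦X⟧) ^ N}) X) ^ N = 0 := by
  rw [← map_pow, Ideal.Quotient.eq_zero_iff_mem]
  exact Ideal.mem_span_singleton_self _

theorem mk_pF_R {N : ℕ} (hN : 1 ≤ N) {z zi : ℂ} (hz : z * zi = 1) :
    Ideal.Quotient.mk (Ideal.span {(X : ℂ⟦X⟧) ^ N}) (pF X N (fun s => C (wR z zi s))) =
    rS (Ideal.Quotient.mk (Ideal.span {(X : ℂ⟦X⟧) ^ N}) X) N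
      (Ideal.Quotient.mk (Ideal.span {(X : ℂ⟦X⟧) ^ N}) (C z))
      (Ideal.Quotient.mk (Ideal.span {(X : ℂ⟦X⟧) ^ N}) (C zi)) := by
  rw [map_pF, ← pF_rank (mkX_pow N) hN]
  · simp [wR]
  · rw [← map_mul, ← map_mul, hz]; simp

theorem mk_pF_C {N : ℕ} (hN : 1 ≤ N) (z zi : ℂ) :
    Ideal.Quotient.mk (Ideal.span {(X : ℂ⟦X⟧) ^ N}) (pF X N (fun s => C (wC z zi s))) =
    cS (Ideal.Quotient.mk (Ideal.span {(X : ℂ⟦X⟧) ^ N}) X) N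
      (Ideal.Quotient.mk (Ideal.span {(X : ℂ⟦X⟧) ^ N}) (C z))
      (Ideal.Quotient.mk (Ideal.span {(X : ℂ⟦X⟧) ^ N}) (C zi)) := by
  rw [map_pF, ← pF_crank (mkX_pow N) hN]
  apply pF_congr
  intro n π _
  unfold wC
  split_ifs <;> simp

theorem sum_R_phi {n N : ℕ} (hn : n < N) {z zi : ℂ} (hz : z * zi = 1) (hz2 : z + zi = 0) :
    ∑ π : n.Partition, wR z zi π.parts = coeff n (phiS (X : ℂ⟦X⟧) N) := by
  rw [← coeff_pF N _ n hn]
  apply coeff_eq_of_mk _ n hn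
  rw [mk_pF_R (by omega) hz, map_phiS]
  apply rS_eq_phi (mkX_pow N) (by omega)
  · rw [← map_mul, ← map_mul, hz]; simp
  · rw [← map_add, ← map_add, hz2]; simp

theorem sum_C_symm {n : ℕ} (hn : 2 ≤ n) {z zi : ℂ} (hz : z * zi = 1) :
    ∑ π : n.Partition, wC z zi π.parts = ∑ π : n.Partition, wC zi z π.parts := by
  have h : coeff n (pF (X : ℂ⟦X⟧) (n + 1) (fun s => C (wC z zi s)) + (C z - 1) * X) =
      coeff n (pF (X : ℂ⟦X⟧) (n + 1) (fun s => C (wC zi z s)) + (C zi - 1) * X) := by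
    apply coeff_eq_of_mk (N := n + 1) _ n (by omega)
    rw [map_add, map_add, mk_pF_C (by omega), mk_pF_C (by omega), map_mul, map_mul, map_sub, map_sub, map_one]
    apply cS_symm (mkX_pow _) (by omega)
    rw [← map_mul, ← map_mul, hz]; simp
  obtain ⟨m, rfl⟩ : ∃ m, n = m + 2 := ⟨n - 2, by omega⟩
  rw [map_add, map_add, coeff_pF _ _ _ (by omega), coeff_pF _ _ _ (by omega), coeff_succ_mul_X, coeff_succ_mul_X] at h
  simpa [coeff_C, coeff_one] using h

theorem sum_main {n : ℕ} (hn : 2 ≤ n) :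
    2 * ((-1) ^ n * coeff n (phiS (X : ℂ⟦X⟧) (n + 1))) =
      ∑ π : n.Partition, wR (-1) (-1) π.parts + ∑ π : n.Partition, wC (-1) (-1) π.parts := by
  have h : coeff n (C 2 * phiS (-X : ℂ⟦X⟧) (n + 1)) =
      coeff n (pF (X : ℂ⟦X⟧) (n + 1) (fun s => C (wR (-1) (-1) s)) + (pF (X : ℂ⟦X⟧) (n + 1) (fun s => C (wC (-1) (-1) s)) + C (-2) * X)) := by
    apply coeff_eq_of_mk (N := n + 1) _ n (by omega)
    rw [map_add, map_add, mk_pF_C (by omega), mk_pF_R (by omega) (by norm_num), map_mul, map_mul, map_phiS]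
    have := main_alg (mkX_pow (n + 1)) (by omega)
    have e1 : (C (-1) : ℂ⟦X⟧) = -1 := by simp
    have e2 : (C 2 : ℂ⟦X⟧) = 2 := map_ofNat (C : ℂ →+* ℂ⟦X⟧) 2
    have e3 : (C (-2) : ℂ⟦X⟧) = -1 - 1 := by rw [map_neg, e2]; ring
    rw [e1, e2, e3]
    simp only [map_neg, map_one, map_sub, map_ofNat]
    exact this
  obtain ⟨m, rfl⟩ : ∃ m, n = m + 2 := ⟨n - 2, by omega⟩
  rw [map_add, map_add, coeff_pF _ _ _ (by omega), coeff_pF _ _ _ (by omega), coeff_succ_mul_X, coeff_C_mul, coeff_phi_neg] at h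
  simpa [coeff_C] using h

theorem ind_zero (r : ℤ) : (4 : ℂ) * (if r % 4 = 0 then 1 else 0) =
    1 + (-1) ^ r + Complex.I ^ r + (-Complex.I) ^ r := by
  have hr : r = 4 * (r / 4) + r % 4 := by omega
  have h4 : ∀ z : ℂ, z ≠ 0 → z ^ (4 : ℕ) = 1 → z ^ r = z ^ (r % 4) := by
    intro z hz h
    conv_lhs => rw [hr, zpow_add₀ hz, zpow_mul]
    rw [show (4 : ℤ) = ((4 : ℕ) : ℤ) by rfl, zpow_natCast, h]; simp
  have hI := Complex.I_ne_zero
  have hI4 := Complex.I_pow_four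
  rw [h4 (-1) (by norm_num) (by norm_num), h4 _ hI hI4, h4 (-Complex.I) (neg_ne_zero.2 hI) (by rw [Even.neg_pow (by decide), hI4])]
  have : r % 4 = 0 ∨ r % 4 = 1 ∨ r % 4 = 2 ∨ r % 4 = 3 := by omega
  rcases this with h | h | h | h <;> rw [h]
  · norm_num
  · norm_num
  · norm_num [zpow_ofNat]
  · have e3 : (-Complex.I) ^ (3 : ℕ) = Complex.I := by
      rw [Odd.neg_pow (by decide), Complex.I_pow_three, neg_neg]
    rw [show (3 : ℤ) = ((3 : ℕ) : ℤ) by rfl]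
    simp only [zpow_natCast]
    rw [e3, Complex.I_pow_three]
    norm_num

theorem ind_one (r : ℤ) : (4 : ℂ) * (if r % 4 = 1 then 1 else 0) =
    1 - (-1) ^ r - Complex.I * (Complex.I ^ r - (-Complex.I) ^ r) := by
  have h := ind_zero (r - 1)
  have hI := Complex.I_ne_zero
  rw [zpow_sub_one₀ (by norm_num), zpow_sub_one₀ hI, zpow_sub_one₀ (neg_ne_zero.2 hI)] at h
  have e : (r - 1) % 4 = 0 ↔ r % 4 = 1 := by omega
  simp only [e] at h
  rw [h, inv_neg, Complex.inv_I]
  norm_num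
  ring

theorem wR_eq {n : ℕ} (π : n.Partition) {z zi : ℂ} (hz : z * zi = 1) :
    wR z zi π.parts = z ^ partitionRank π := by
  have h0 : z ≠ 0 := left_ne_zero_of_mul_eq_one hz
  have : zi = z⁻¹ := eq_inv_of_mul_eq_one_right hz
  rw [wR, partitionRank, zpow_sub₀ h0, this]
  simp [div_eq_mul_inv]

theorem wC_eq {n : ℕ} (π : n.Partition) {z zi : ℂ} (hz : z * zi = 1) :
    wC z zi π.parts = z ^ partitionCrank π := by
  have h0 : z ≠ 0 := left_ne_zero_of_mul_eq_one hz
  have : zi = z⁻¹ := eq_inv_of_mul_eq_one_right hz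
  rw [wC, partitionCrank]
  split_ifs
  · simp
  · rw [zpow_sub₀ h0, this]
    simp [div_eq_mul_inv]

end final

theorem stmt_13 : ∀ n : ℕ, 1 ≤ n → rankCount 0 4 (2 * n + 1) = crankCount 1 4 (2 * n + 1) := by
  intro m hm
  set n := 2 * m + 1 with hn
  have hI : Complex.I * (-Complex.I) = 1 := by rw [mul_neg, Complex.I_mul_I]; simp
  have hI' : (-Complex.I) * Complex.I = 1 := by rw [neg_mul, Complex.I_mul_I]; simp
  have hm1 : (-1 : ℂ) * (-1) = 1 := by norm_num
  have hR : (4 : ℂ) * rankCount 0 4 n = ∑ π : n.Partition, (1 : ℂ) + ∑ π : n.Partition, wR (-1) (-1) π.parts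
      + ∑ π : n.Partition, wR Complex.I (-Complex.I) π.parts + ∑ π : n.Partition, wR (-Complex.I) Complex.I π.parts := by
    rw [rankCount, Finset.card_filter, Nat.cast_sum, Finset.mul_sum, ← Finset.sum_add_distrib,
      ← Finset.sum_add_distrib, ← Finset.sum_add_distrib]
    apply Finset.sum_congr rfl
    intro π _
    rw [wR_eq π hm1, wR_eq π hI, wR_eq π hI', ← ind_zero]
    simp
  have hC : (4 : ℂ) * crankCount 1 4 n = ∑ π : n.Partition, (1 : ℂ) - ∑ π : n.Partition, wC (-1) (-1) π.parts
      - Complex.I * (∑ π : n.Partition, wC Complex.I (-Complex.I) π.parts - ∑ π : n.Partition, wC (-Complex.I) Complex.I π.parts) := by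
    rw [crankCount, Finset.card_filter, Nat.cast_sum, Finset.mul_sum, ← Finset.sum_sub_distrib,
      ← Finset.sum_sub_distrib, Finset.mul_sum, ← Finset.sum_sub_distrib]
    apply Finset.sum_congr rfl
    intro π _
    rw [wC_eq π hm1, wC_eq π hI, wC_eq π hI', ← ind_one]
    simp
  have h1 := sum_R_phi (n := n) (N := n + 1) (by omega) hI (by ring)
  have h2 := sum_R_phi (n := n) (N := n + 1) (by omega) hI' (by ring)
  have h3 := sum_C_symm (n := n) (by omega) hI
  have h4 := sum_main (n := n) (by omega)
  have hodd : (-1 : ℂ) ^ n = -1 := Odd.neg_one_pow ⟨m, hn⟩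
  rw [hodd] at h4
  rw [h1, h2] at hR
  rw [h3] at hC
  have : (4 : ℂ) * rankCount 0 4 n = 4 * crankCount 1 4 n := by
    rw [hR, hC]
    linear_combination -h4
  have h5 : ((rankCount 0 4 n : ℕ) : ℂ) = crankCount 1 4 n := by
    linear_combination this / 4
  exact_mod_cast h5
end
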